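/- Let (X, T) be a topological dynamical system (X a compact metric space, T : X → X a homeomorphism). Then for every finite open cover 𝓤 of X there exists a T-invariant ergodic Borel probability measure μ on X such that h_μ(𝓤, T) = h_top(𝓤, T). -/

import Mathlib

open MeasureTheory Filter Topology
open scoped Classical

variable {X : Type*} [MeasurableSpace X]

noncomputable def cJoin (U V : Finset (Set X)) : Finset (Set X) :=
  (U ×ˢ V).image fun p => p.1 ∩ p.2

noncomputable def preC (S : X → X) (U : Finset (Set X)) : Finset (Set X) :=
  U.image fun A => S ⁻¹' A

noncomputable def joinN (S : X → X) (U : Finset (Set X)) : ℕ → Finset (Set X)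
  | 0 => {Set.univ}
  | n + 1 => cJoin (joinN S U n) (preC (S^[n]) U)

def IsMCover (U : Finset (Set X)) : Prop :=
  (∀ A ∈ U, MeasurableSet A) ∧ ⋃₀ (U : Set (Set X)) = Set.univ

def IsMPartition (U : Finset (Set X)) : Prop :=
  IsMCover U ∧ ∀ A ∈ U, ∀ B ∈ U, A ≠ B → Disjoint A B

def Refines (α U : Finset (Set X)) : Prop := ∀ A ∈ α, ∃ B ∈ U, A ⊆ B

noncomputable def entPart (μ : Measure X) (α : Finset (Set X)) : ℝ :=
  ∑ A ∈ α, Real.negMulLog (μ A).toReal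

noncomputable def entCover (μ : Measure X) (U : Finset (Set X)) : ℝ :=
  sInf {h | ∃ α : Finset (Set X), IsMPartition α ∧ Refines α U ∧ h = entPart μ α}

noncomputable def hPart (μ : Measure X) (S : X → X) (α : Finset (Set X)) : ℝ :=
  limUnder atTop fun n : ℕ => entPart μ (joinN S α n) / n

noncomputable def hPlusC (μ : Measure X) (S : X → X) (U : Finset (Set X)) : ℝ :=
  sInf {h | ∃ α : Finset (Set X), IsMPartition α ∧ Refines α U ∧ h = hPart μ S α}

noncomputable def hMinusC (μ : Measure X) (S : X → X) (U : Finset (Set X)) : ℝ :=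
  limUnder atTop fun n : ℕ => entCover μ (joinN S U n) / n

noncomputable def covN (μ : Measure X) (V : Finset (Set X)) (ε : ℝ) : ℕ :=
  sInf {m | ∃ W ⊆ V, W.card = m ∧ 1 - ε < (μ (⋃₀ (W : Set (Set X)))).toReal}

noncomputable def covNfull (V : Finset (Set X)) : ℕ :=
  sInf {m | ∃ W ⊆ V, W.card = m ∧ ⋃₀ (W : Set (Set X)) = Set.univ}

section Entropy

variable {Ω κ κ₂ : Type*} [MeasurableSpace Ω] [Fintype κ] [Fintype κ₂]

/-- Shannon entropy of a finite-valued function. -/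
noncomputable def shEnt (μ : Measure Ω) (f : Ω → κ) : ℝ :=
  ∑ k, Real.negMulLog (μ.real (f ⁻¹' ({k} : Set κ)))

/-- A function all of whose fibres are measurable. -/
def FibMeas {Ω κ : Type*} [MeasurableSpace Ω] (f : Ω → κ) : Prop :=
  ∀ k, MeasurableSet (f ⁻¹' ({k} : Set κ))

/-- The itinerary of length `n` under `T`, read through the labelling `f`. -/
def word {Ω κ : Type*} (T : Ω → Ω) (f : Ω → κ) (n : ℕ) : Ω → Fin n → κ :=
  fun x j => f (T^[j] x)

omit [Fintype κ] in
lemma FibMeas.comp {Ω' : Type*} [MeasurableSpace Ω'] {f : Ω → κ} (hf : FibMeas f)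
    {g : Ω' → Ω} (hg : Measurable g) : FibMeas (f ∘ g) :=
  fun k => hg (hf k)

omit [Fintype κ] [Fintype κ₂] in
lemma FibMeas.prodMk {f : Ω → κ} {g : Ω → κ₂} (hf : FibMeas f) (hg : FibMeas g) :
    FibMeas (fun x => (f x, g x)) := by
  rintro ⟨a, b⟩
  have : (fun x => (f x, g x)) ⁻¹' {(a, b)} = f ⁻¹' {a} ∩ g ⁻¹' {b} := by
    ext x; simp
  rw [this]; exact (hf a).inter (hg b)

lemma word_preimage {Ω κ : Type*} (T : Ω → Ω) (f : Ω → κ) (n : ℕ) (w : Fin n → κ) :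
    word T f n ⁻¹' {w} = ⋂ j : Fin n, T^[j] ⁻¹' (f ⁻¹' {w j}) := by
  ext x; simp [word, funext_iff]

omit [Fintype κ] in
lemma FibMeas.word {f : Ω → κ} (hf : FibMeas f) {T : Ω → Ω} (hT : Measurable T) (n : ℕ) :
    FibMeas (word T f n) := by
  intro w
  rw [word_preimage]
  exact MeasurableSet.iInter fun j => (hT.iterate _) (hf _)

lemma sum_measureReal_inter_fiber (μ : Measure Ω) [IsFiniteMeasure μ] {f : Ω → κ}
    (hf : FibMeas f) {S : Set Ω} (hS : MeasurableSet S) :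
    ∑ k, μ.real (S ∩ f ⁻¹' {k}) = μ.real S := by
  rw [← measureReal_iUnion_fintype]
  · congr 1
    ext x; simp
  · intro a b hab
    refine Set.disjoint_left.2 fun x hx hy => hab ?_
    simp only [Set.mem_inter_iff, Set.mem_preimage, Set.mem_singleton_iff] at hx hy
    exact hx.2.symm.trans hy.2
  · exact fun k => hS.inter (hf k)

lemma sum_measureReal_fiber (μ : Measure Ω) [IsProbabilityMeasure μ] {f : Ω → κ}
    (hf : FibMeas f) : ∑ k, μ.real (f ⁻¹' {k}) = 1 := by
  simpa using sum_measureReal_inter_fiber μ hf MeasurableSet.univ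

/-- Gibbs' inequality. -/
lemma sum_negMulLog_le {p q : κ → ℝ} (hp : ∀ k, 0 ≤ p k) (hq : ∀ k, 0 ≤ q k)
    (hpq : ∀ k, q k = 0 → p k = 0) (hp1 : ∑ k, p k = 1) (hq1 : ∑ k, q k ≤ 1) :
    ∑ k, Real.negMulLog (p k) ≤ ∑ k, p k * -Real.log (q k) := by
  have key : ∀ k, Real.negMulLog (p k) ≤ p k * -Real.log (q k) + (q k - p k) := by
    intro k
    rcases (hp k).eq_or_lt with h | h
    · rw [← h]; simpa using hq k
    · have hq' : 0 < q k := (hq k).lt_of_ne fun h' => h.ne' (hpq k h'.symm)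
      have := Real.log_le_sub_one_of_pos (div_pos hq' h)
      rw [Real.log_div hq'.ne' h.ne'] at this
      have h2 := mul_le_mul_of_nonneg_left this h.le
      have h3 : p k * (q k / p k - 1) = q k - p k := by field_simp
      rw [h3] at h2
      rw [Real.negMulLog]
      linarith
  calc _ ≤ ∑ k, (p k * -Real.log (q k) + (q k - p k)) := Finset.sum_le_sum fun k _ => key k
    _ = ∑ k, p k * -Real.log (q k) + (∑ k, q k - ∑ k, p k) := by
        rw [Finset.sum_add_distrib, Finset.sum_sub_distrib]
    _ ≤ _ := by linarith

lemma shEnt_nonneg (μ : Measure Ω) [IsProbabilityMeasure μ] (f : Ω → κ) : 0 ≤ shEnt μ f :=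
  Finset.sum_nonneg fun _ _ => Real.negMulLog_nonneg measureReal_nonneg measureReal_le_one

lemma shEnt_le_of_fiber (μ : Measure Ω) [IsProbabilityMeasure μ] {f : Ω → κ} (hf : FibMeas f)
    {C : ℝ} (h : ∀ k, μ.real (f ⁻¹' {k}) ≠ 0 → -Real.log (μ.real (f ⁻¹' {k})) ≤ C) :
    shEnt μ f ≤ C := by
  have : shEnt μ f ≤ ∑ k, μ.real (f ⁻¹' {k}) * C := by
    refine Finset.sum_le_sum fun k _ => ?_
    by_cases hk : μ.real (f ⁻¹' {k}) = 0
    · simp [hk]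
    · rw [Real.negMulLog, neg_mul, ← mul_neg]
      exact mul_le_mul_of_nonneg_left (h k hk) measureReal_nonneg
  rwa [← Finset.sum_mul, sum_measureReal_fiber μ hf, one_mul] at this

lemma shEnt_le_log_card (μ : Measure Ω) [IsProbabilityMeasure μ] {f : Ω → κ} (hf : FibMeas f) :
    shEnt μ f ≤ Real.log (Fintype.card κ) := by
  obtain ⟨x⟩ : Nonempty Ω := nonempty_of_isProbabilityMeasure μ
  have : Nonempty κ := ⟨f x⟩
  have hc : (0 : ℝ) < Fintype.card κ := by exact_mod_cast Fintype.card_pos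
  have := sum_negMulLog_le (p := fun k => μ.real (f ⁻¹' {k}))
    (q := fun _ => (Fintype.card κ : ℝ)⁻¹) (fun _ => measureReal_nonneg)
    (fun _ => by positivity) (fun _ h => absurd h (by positivity)) (sum_measureReal_fiber μ hf)
    (by simp)
  refine this.trans ?_
  rw [← Finset.sum_mul, sum_measureReal_fiber μ hf]
  simp

lemma shEnt_mono (μ : Measure Ω) [IsProbabilityMeasure μ] {f : Ω → κ} {g : Ω → κ₂}
    (hf : FibMeas f) (hg : FibMeas g) (h : ∀ x y, g x = g y → f x = f y) :
    shEnt μ f ≤ shEnt μ g := by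
  have e1 : shEnt μ f = ∑ a, ∑ b, μ.real (f ⁻¹' {a} ∩ g ⁻¹' {b}) *
      -Real.log (μ.real (f ⁻¹' {a})) := by
    refine Finset.sum_congr rfl fun a _ => ?_
    rw [← Finset.sum_mul, sum_measureReal_inter_fiber μ hg (hf a), Real.negMulLog]; ring
  have e2 : shEnt μ g = ∑ a, ∑ b, μ.real (f ⁻¹' {a} ∩ g ⁻¹' {b}) *
      -Real.log (μ.real (g ⁻¹' {b})) := by
    rw [Finset.sum_comm]
    refine Finset.sum_congr rfl fun b _ => ?_
    simp_rw [Set.inter_comm (f ⁻¹' _)]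
    rw [← Finset.sum_mul, sum_measureReal_inter_fiber μ hf (hg b), Real.negMulLog]; ring
  rw [e1, e2]
  refine Finset.sum_le_sum fun a _ => Finset.sum_le_sum fun b _ => ?_
  rcases (measureReal_nonneg (μ := μ) (s := f ⁻¹' {a} ∩ g ⁻¹' {b})).eq_or_lt with h0 | h0
  · rw [← h0]; simp
  · refine mul_le_mul_of_nonneg_left (neg_le_neg ?_) h0.le
    obtain ⟨x, hx⟩ : (f ⁻¹' {a} ∩ g ⁻¹' {b}).Nonempty := by
      by_contra hne
      rw [Set.not_nonempty_iff_eq_empty] at hne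
      rw [hne] at h0; simp at h0
    refine Real.log_le_log (h0.trans_le (measureReal_mono Set.inter_subset_right))
      (measureReal_mono fun y hy => ?_)
    have := h y x (Eq.trans hy hx.2.symm)
    exact this.trans hx.1

lemma shEnt_prodMk_le (μ : Measure Ω) [IsProbabilityMeasure μ] {f : Ω → κ} {g : Ω → κ₂}
    (hf : FibMeas f) (hg : FibMeas g) :
    shEnt μ (fun x => (f x, g x)) ≤ shEnt μ f + shEnt μ g := by
  have hpre : ∀ k : κ × κ₂, (fun x => (f x, g x)) ⁻¹' {k} = f ⁻¹' {k.1} ∩ g ⁻¹' {k.2} := by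
    rintro ⟨a, b⟩; ext x; simp
  have hle1 : ∀ k : κ × κ₂, μ.real ((fun x => (f x, g x)) ⁻¹' {k}) ≤ μ.real (f ⁻¹' {k.1}) :=
    fun k => by rw [hpre]; exact measureReal_mono Set.inter_subset_left
  have hle2 : ∀ k : κ × κ₂, μ.real ((fun x => (f x, g x)) ⁻¹' {k}) ≤ μ.real (g ⁻¹' {k.2}) :=
    fun k => by rw [hpre]; exact measureReal_mono Set.inter_subset_right
  have := sum_negMulLog_le (p := fun k : κ × κ₂ => μ.real ((fun x => (f x, g x)) ⁻¹' {k}))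
    (q := fun k => μ.real (f ⁻¹' {k.1}) * μ.real (g ⁻¹' {k.2})) (fun _ => measureReal_nonneg)
    (fun _ => by positivity)
    (fun k h => by
      rcases mul_eq_zero.1 h with h | h
      · exact le_antisymm (h ▸ hle1 k) measureReal_nonneg
      · exact le_antisymm (h ▸ hle2 k) measureReal_nonneg)
    (sum_measureReal_fiber μ (hf.prodMk hg))
    (by
      rw [Fintype.sum_prod_type]
      simp_rw [← Finset.mul_sum, sum_measureReal_fiber μ hg, mul_one]
      exact (sum_measureReal_fiber μ hf).le)
  refine this.trans (le_of_eq ?_)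
  have e : ∀ k : κ × κ₂, μ.real ((fun x => (f x, g x)) ⁻¹' {k}) *
      -Real.log (μ.real (f ⁻¹' {k.1}) * μ.real (g ⁻¹' {k.2})) =
      μ.real (f ⁻¹' {k.1} ∩ g ⁻¹' {k.2}) * -Real.log (μ.real (f ⁻¹' {k.1})) +
      μ.real (f ⁻¹' {k.1} ∩ g ⁻¹' {k.2}) * -Real.log (μ.real (g ⁻¹' {k.2})) := by
    intro k
    by_cases h0 : μ.real ((fun x => (f x, g x)) ⁻¹' {k}) = 0
    · rw [h0, ← hpre, h0]; simp
    · have hpos := lt_of_le_of_ne measureReal_nonneg (Ne.symm h0)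
      rw [Real.log_mul (hpos.trans_le (hle1 k)).ne' (hpos.trans_le (hle2 k)).ne', hpre]; ring
  simp_rw [e, Finset.sum_add_distrib, Fintype.sum_prod_type]
  congr 1
  · refine Finset.sum_congr rfl fun a _ => ?_
    rw [← Finset.sum_mul, sum_measureReal_inter_fiber μ hg (hf a), Real.negMulLog]; ring
  · rw [Finset.sum_comm]
    refine Finset.sum_congr rfl fun b _ => ?_
    simp_rw [Set.inter_comm (f ⁻¹' _)]
    rw [← Finset.sum_mul, sum_measureReal_inter_fiber μ hf (hg b), Real.negMulLog]; ring

lemma shEnt_comp_eq {μ : Measure Ω} {f : Ω → κ} (hf : FibMeas f) {T : Ω → Ω}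
    (hT : MeasurePreserving T μ μ) : shEnt μ (f ∘ T) = shEnt μ f := by
  refine Finset.sum_congr rfl fun k _ => ?_
  rw [Set.preimage_comp, measureReal_def, hT.measure_preimage (hf k).nullMeasurableSet,
    ← measureReal_def]

lemma shEnt_map {Ω' : Type*} [MeasurableSpace Ω'] (μ : Measure Ω) {f : Ω' → κ} (hf : FibMeas f)
    {T : Ω → Ω'} (hT : Measurable T) : shEnt (μ.map T) f = shEnt μ (f ∘ T) := by
  refine Finset.sum_congr rfl fun k _ => ?_
  rw [Set.preimage_comp, map_measureReal_apply hT (hf k)]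

/-- Splitting an itinerary at time `m`. -/
lemma shEnt_word_add_le (μ : Measure Ω) [IsProbabilityMeasure μ] {T : Ω → Ω} (hT : Measurable T)
    {f : Ω → κ} (hf : FibMeas f) (m n : ℕ) :
    shEnt μ (word T f (m + n)) ≤ shEnt μ (word T f m) + shEnt μ (word T f n ∘ T^[m]) := by
  refine le_trans ?_ (shEnt_prodMk_le μ (hf.word hT m) ((hf.word hT n).comp (hT.iterate m)))
  refine shEnt_mono μ (hf.word hT _)
    ((hf.word hT m).prodMk ((hf.word hT n).comp (hT.iterate m))) fun x y hxy => ?_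
  rw [Prod.mk.injEq] at hxy
  funext j
  refine Fin.addCases (fun i => ?_) (fun i => ?_) j
  · exact congrFun hxy.1 i
  · have := congrFun hxy.2 i
    simpa [word, ← Function.iterate_add_apply, add_comm] using this

lemma shEnt_word_mono (μ : Measure Ω) [IsProbabilityMeasure μ] {T : Ω → Ω} (hT : Measurable T)
    {f : Ω → κ} (hf : FibMeas f) {m n : ℕ} (h : m ≤ n) :
    shEnt μ (word T f m) ≤ shEnt μ (word T f n) :=
  shEnt_mono μ (hf.word hT _) (hf.word hT _) fun _ _ hxy =>
    funext fun j => congrFun hxy ⟨j, j.2.trans_le h⟩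

lemma shEnt_word_le_log (μ : Measure Ω) [IsProbabilityMeasure μ] {T : Ω → Ω} (hT : Measurable T)
    {f : Ω → κ} (hf : FibMeas f) (n : ℕ) :
    shEnt μ (word T f n) ≤ n * Real.log (Fintype.card κ) := by
  simpa using shEnt_le_log_card μ (hf.word hT n)

lemma subadditive_shEnt_word {μ : Measure Ω} [IsProbabilityMeasure μ] {T : Ω → Ω}
    (hT : MeasurePreserving T μ μ) {f : Ω → κ} (hf : FibMeas f) :
    Subadditive fun n => shEnt μ (word T f n) := fun m n => by
  have := shEnt_word_add_le μ hT.measurable hf m n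
  rwa [shEnt_comp_eq (hf.word hT.measurable n) (hT.iterate m)] at this

lemma shEnt_word_mul_le {μ : Measure Ω} [IsProbabilityMeasure μ] {T : Ω → Ω}
    (hT : MeasurePreserving T μ μ) {f : Ω → κ} (hf : FibMeas f) (k n : ℕ) :
    shEnt μ (word T f (k * n)) ≤ k * shEnt μ (word T f n) := by
  have h0 : shEnt μ (word T f 0) ≤ 0 := by
    simpa using shEnt_word_le_log μ hT.measurable hf 0
  have : shEnt μ (word T f (k * n)) ≤ k * shEnt μ (word T f n) + shEnt μ (word T f 0) :=
    (subadditive_shEnt_word hT hf).apply_mul_add_le k n 0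
  linarith

lemma shEnt_word_le_mul {μ : Measure Ω} [IsProbabilityMeasure μ] {T : Ω → Ω}
    (hT : MeasurePreserving T μ μ) {f : Ω → κ} (hf : FibMeas f) (n : ℕ) :
    shEnt μ (word T f n) ≤ n * shEnt μ f := by
  have := shEnt_word_mul_le hT hf n 1
  rw [mul_one] at this
  refine this.trans (mul_le_mul_of_nonneg_left ?_ (by positivity))
  refine shEnt_mono μ (hf.word hT.measurable _) hf fun x y hxy => funext fun j => ?_
  have : (j : ℕ) = 0 := by omega
  simpa [word, this] using hxy

end Entropy

section Covers

/-- The points whose itinerary under `T` follows the sets `V (w 0), V (w 1), …`. -/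
def cell {Ω ι : Type*} (T : Ω → Ω) (V : ι → Set Ω) {n : ℕ} (w : Fin n → ι) : Set Ω :=
  {x | ∀ j, T^[j] x ∈ V (w j)}

lemma mem_joinN {Ω : Type*} (T : Ω → Ω) (U : Finset (Set Ω)) (n : ℕ) (A : Set Ω) :
    A ∈ joinN T U n ↔ ∃ w : Fin n → ↥U, A = cell T (fun i : ↥U => (i : Set Ω)) w := by
  induction n generalizing A with
  | zero =>
    simp only [joinN, Finset.mem_singleton]
    constructor
    · rintro rfl
      exact ⟨Fin.elim0, by ext x; simp [cell]⟩
    · rintro ⟨w, rfl⟩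
      ext x; simp [cell]
  | succ n ih =>
    simp only [joinN, cJoin, preC, Finset.mem_image, Finset.mem_product, Prod.exists]
    constructor
    · rintro ⟨B, C, ⟨hB, D, hD, rfl⟩, rfl⟩
      obtain ⟨w, rfl⟩ := (ih B).1 hB
      refine ⟨Fin.snoc (α := fun _ => ↥U) w ⟨D, hD⟩, ?_⟩
      ext x
      simp [cell, Fin.forall_fin_succ']
    · rintro ⟨w, rfl⟩
      refine ⟨_, _, ⟨(ih _).2 ⟨Fin.init w, rfl⟩, _, (w (Fin.last n)).2, rfl⟩, ?_⟩
      ext x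
      simp [cell, Fin.forall_fin_succ', Fin.init]

/-- A point-to-member choice function for a cover. -/
lemma exists_label {Ω : Type*} {U : Finset (Set Ω)} (h : ⋃₀ (U : Set (Set Ω)) = Set.univ) :
    ∃ f : Ω → ↥U, ∀ x, x ∈ (f x : Set Ω) := by
  have : ∀ x, ∃ A : ↥U, x ∈ (A : Set Ω) := fun x => by
    have hx : x ∈ ⋃₀ (U : Set (Set Ω)) := h ▸ Set.mem_univ x
    obtain ⟨A, hA, hxA⟩ := hx
    exact ⟨⟨A, hA⟩, hxA⟩
  choose f hf using this
  exact ⟨f, hf⟩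

/-- A finite measurable cover has a measurable choice of member. -/
lemma exists_fibMeas_label {Ω ι : Type*} [MeasurableSpace Ω] [Fintype ι] [Nonempty ι]
    {V : ι → Set Ω} (hV : ∀ i, MeasurableSet (V i)) (hcov : ∀ x, ∃ i, x ∈ V i) :
    ∃ g : Ω → ι, FibMeas g ∧ ∀ x, x ∈ V (g x) := by
  have key : ∀ s : Finset ι, ∃ g : Ω → ι, FibMeas g ∧ ∀ i ∈ s, ∀ x ∈ V i, x ∈ V (g x) := by
    intro s
    induction s using Finset.induction_on with
    | empty =>
      refine ⟨fun _ => Classical.arbitrary ι, fun k => ?_, by simp⟩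
      by_cases h : Classical.arbitrary ι = k <;> simp [h]
    | insert a s _ ih =>
      obtain ⟨g, hg, hgs⟩ := ih
      refine ⟨fun x => if x ∈ V a then a else g x, fun k => ?_, fun i hi x hx => ?_⟩
      · have : (fun x => if x ∈ V a then a else g x) ⁻¹' {k}
            = (V a ∩ {_x | a = k}) ∪ ((V a)ᶜ ∩ g ⁻¹' {k}) := by
          ext x
          by_cases hx : x ∈ V a <;> simp [hx]
        rw [this]
        exact ((hV a).inter (MeasurableSet.const _)).union ((hV a).compl.inter (hg k))
      · by_cases hxa : x ∈ V a
        · simp [hxa]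
        · have : i ∈ s := by
            rcases Finset.mem_insert.1 hi with rfl | h
            · exact absurd hx hxa
            · exact h
          simpa [hxa] using hgs i this x hx
  obtain ⟨g, hg, hgs⟩ := key Finset.univ
  refine ⟨g, hg, fun x => ?_⟩
  obtain ⟨i, hi⟩ := hcov x
  exact hgs i (Finset.mem_univ i) x hi

section Partition

variable {Ω : Type*} [MeasurableSpace Ω]

lemma preimage_label_of_partition {α : Finset (Set Ω)} (hα : IsMPartition α) {f : Ω → ↥α}
    (hf : ∀ x, x ∈ (f x : Set Ω)) (A : ↥α) : f ⁻¹' {A} = A := by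
  ext x
  constructor
  · intro h
    have : f x = A := h
    exact this ▸ hf x
  · intro h
    by_contra hne
    have hne' : (f x : Set Ω) ≠ A := fun e => hne (Subtype.ext e)
    exact Set.disjoint_left.1 (hα.2 _ (f x).2 _ A.2 hne') (hf x) h

lemma fibMeas_label_of_partition {α : Finset (Set Ω)} (hα : IsMPartition α) {f : Ω → ↥α}
    (hf : ∀ x, x ∈ (f x : Set Ω)) : FibMeas f := fun A => by
  rw [preimage_label_of_partition hα hf]
  exact hα.1.1 _ A.2

lemma entPart_joinN (μ : Measure Ω) (T : Ω → Ω) {α : Finset (Set Ω)} (hα : IsMPartition α)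
    {f : Ω → ↥α} (hf : ∀ x, x ∈ (f x : Set Ω)) (n : ℕ) :
    entPart μ (joinN T α n) = shEnt μ (word T f n) := by
  have hcell : ∀ w : Fin n → ↥α,
      cell T (fun i : ↥α => (i : Set Ω)) w = word T f n ⁻¹' {w} := by
    intro w
    rw [word_preimage]
    ext x
    simp only [cell, Set.mem_ofPred_eq, Set.mem_iInter, preimage_label_of_partition hα hf,
      Set.mem_preimage]
  have himg : joinN T α n = Finset.univ.image
      fun w : Fin n → ↥α => cell T (fun i : ↥α => (i : Set Ω)) w := by
    ext A
    simp [mem_joinN, eq_comm]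
  rw [himg, entPart, shEnt, Finset.sum_image_of_pairwise_eq_zero]
  · exact Finset.sum_congr rfl fun w _ => by rw [hcell, measureReal_def]
  · intro w _ w' _ hne heq
    have : cell T (fun i : ↥α => (i : Set Ω)) w = ∅ := by
      by_contra h
      obtain ⟨x, hx⟩ := Set.nonempty_iff_ne_empty.2 h
      have h2 : x ∈ cell T (fun i : ↥α => (i : Set Ω)) w' := heq ▸ hx
      rw [hcell] at hx h2
      exact hne (hx.symm.trans h2)
    simp [this]

lemma tendsto_hPart {μ : Measure Ω} [IsProbabilityMeasure μ] {T : Ω → Ω}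
    (hT : MeasurePreserving T μ μ) {α : Finset (Set Ω)} (hα : IsMPartition α)
    {f : Ω → ↥α} (hf : ∀ x, x ∈ (f x : Set Ω)) :
    Tendsto (fun n : ℕ => shEnt μ (word T f n) / n) atTop (𝓝 (hPart μ T α)) ∧
      ∀ n ≠ 0, hPart μ T α ≤ shEnt μ (word T f n) / n := by
  have hsub := subadditive_shEnt_word hT (fibMeas_label_of_partition hα hf)
  have hb : BddBelow (Set.range fun n : ℕ => shEnt μ (word T f n) / n) :=
    ⟨0, by rintro _ ⟨n, rfl⟩; exact div_nonneg (shEnt_nonneg _ _) n.cast_nonneg⟩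
  have ht := hsub.tendsto_lim hb
  have he : hPart μ T α = hsub.lim := by
    simp only [hPart, entPart_joinN μ T hα hf]
    exact ht.limUnder_eq
  rw [he]
  exact ⟨ht, fun n hn => hsub.lim_le_div hb hn⟩

lemma le_hPart {μ : Measure Ω} [IsProbabilityMeasure μ] {T : Ω → Ω}
    (hT : MeasurePreserving T μ μ) {α : Finset (Set Ω)} (hα : IsMPartition α)
    {f : Ω → ↥α} (hf : ∀ x, x ∈ (f x : Set Ω)) {c : ℝ}
    (hc : ∀ n : ℕ, n * c ≤ shEnt μ (word T f n)) : c ≤ hPart μ T α := by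
  refine ge_of_tendsto (tendsto_hPart hT hα hf).1 ?_
  filter_upwards [eventually_gt_atTop 0] with n hn
  rw [le_div_iff₀ (by exact_mod_cast hn), mul_comm]
  exact hc n

/-- The fibres of a labelling subordinate to `U` form a partition refining `U`. -/
lemma exists_partition_of_label {U : Finset (Set Ω)} {g : Ω → ↥U} (hg : FibMeas g)
    (hgU : ∀ x, x ∈ (g x : Set Ω)) :
    ∃ α : Finset (Set Ω), IsMPartition α ∧ Refines α U ∧
      ∃ f : Ω → ↥α, (∀ x, x ∈ (f x : Set Ω)) ∧ ∀ x y, g x = g y → f x = f y := by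
  refine ⟨Finset.univ.image fun i => g ⁻¹' {i}, ⟨⟨?_, ?_⟩, ?_⟩, ?_,
    fun x => ⟨g ⁻¹' {g x}, Finset.mem_image_of_mem _ (Finset.mem_univ _)⟩, fun x => rfl, ?_⟩
  · intro A hA
    obtain ⟨i, -, rfl⟩ := Finset.mem_image.1 hA
    exact hg i
  · refine Set.eq_univ_of_forall fun x => ⟨g ⁻¹' {g x}, ?_, rfl⟩
    exact Finset.mem_coe.2 (Finset.mem_image_of_mem _ (Finset.mem_univ _))
  · intro A hA B hB hne
    obtain ⟨i, -, rfl⟩ := Finset.mem_image.1 hA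
    obtain ⟨j, -, rfl⟩ := Finset.mem_image.1 hB
    refine Set.disjoint_left.2 fun x hx hy => hne ?_
    have hi : g x = i := hx
    have hj : g x = j := hy
    rw [← hi, ← hj]
  · intro A hA
    obtain ⟨i, -, rfl⟩ := Finset.mem_image.1 hA
    refine ⟨i, i.2, fun x hx => ?_⟩
    have hi : g x = i := hx
    exact hi ▸ hgU x
  · intro x y h
    simp [h]

lemma bddBelow_hPlusC {μ : Measure Ω} [IsProbabilityMeasure μ] {T : Ω → Ω}
    (hT : MeasurePreserving T μ μ) (U : Finset (Set Ω)) :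
    BddBelow {h | ∃ α : Finset (Set Ω), IsMPartition α ∧ Refines α U ∧ h = hPart μ T α} := by
  refine ⟨0, ?_⟩
  rintro _ ⟨α, hα, -, rfl⟩
  obtain ⟨f, hf⟩ := exists_label hα.1.2
  exact le_hPart hT hα hf fun n => by simpa using shEnt_nonneg μ _

lemma hPlusC_le {μ : Measure Ω} [IsProbabilityMeasure μ] {T : Ω → Ω}
    (hT : MeasurePreserving T μ μ) {U : Finset (Set Ω)} {g : Ω → ↥U} (hg : FibMeas g)
    (hgU : ∀ x, x ∈ (g x : Set Ω)) {n : ℕ} (hn : n ≠ 0) :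
    hPlusC μ T U ≤ shEnt μ (word T g n) / n := by
  obtain ⟨α, hα, hαU, f, hf, hfg⟩ := exists_partition_of_label hg hgU
  refine (csInf_le (bddBelow_hPlusC hT U) ⟨α, hα, hαU, rfl⟩).trans ?_
  refine ((tendsto_hPart hT hα hf).2 n hn).trans ?_
  refine div_le_div_of_nonneg_right ?_ n.cast_nonneg
  exact shEnt_mono μ ((fibMeas_label_of_partition hα hf).word hT.measurable n)
    (hg.word hT.measurable n) fun x y h => funext fun j => hfg _ _ (congrFun h j)

lemma le_hPlusC {μ : Measure Ω} [IsProbabilityMeasure μ] {T : Ω → Ω}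
    (hT : MeasurePreserving T μ μ) {U : Finset (Set Ω)} (hU : IsMCover U) {c : ℝ}
    (hc : ∀ g : Ω → ↥U, FibMeas g → (∀ x, x ∈ (g x : Set Ω)) →
      ∀ n : ℕ, n * c ≤ shEnt μ (word T g n)) : c ≤ hPlusC μ T U := by
  obtain ⟨x⟩ : Nonempty Ω := nonempty_of_isProbabilityMeasure μ
  obtain ⟨g₀, -⟩ := exists_label hU.2
  have : Nonempty ↥U := ⟨g₀ x⟩
  refine le_csInf ?_ ?_
  · obtain ⟨g, hg, hgU⟩ := exists_fibMeas_label (V := fun i : ↥U => (i : Set Ω))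
      (fun i => hU.1 _ i.2) fun x => by
        obtain ⟨f, hf⟩ := exists_label hU.2
        exact ⟨f x, hf x⟩
    obtain ⟨α, hα, hαU, -⟩ := exists_partition_of_label hg hgU
    exact ⟨_, α, hα, hαU, rfl⟩
  · rintro _ ⟨α, hα, hαU, rfl⟩
    obtain ⟨f, hf⟩ := exists_label hα.1.2
    choose φ hφ hφ' using hαU
    have hfm := fibMeas_label_of_partition hα hf
    let g : Ω → ↥U := fun x => ⟨φ (f x) (f x).2, hφ _ _⟩
    have hfg : ∀ x y, f x = f y → g x = g y := fun x y h =>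
      congrArg (fun a : ↥α => (⟨φ a a.2, hφ _ _⟩ : ↥U)) h
    have hg : FibMeas g := by
      intro k
      have : g ⁻¹' {k} = ⋃ a ∈ {a : ↥α | (⟨φ a a.2, hφ _ _⟩ : ↥U) = k}, f ⁻¹' {a} := by
        ext x; simp [g]
      rw [this]
      exact MeasurableSet.biUnion (Set.toFinite _).countable fun a _ => hfm a
    refine le_hPart hT hα hf fun n => (hc g hg (fun x => hφ' _ _ (hf x)) n).trans ?_
    exact shEnt_mono μ (hg.word hT.measurable n) (hfm.word hT.measurable n)
      fun x y h => funext fun j => hfg _ _ (congrFun h j)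

end Partition

section Topological

variable {Ω : Type*} (T : Ω → Ω) {U : Finset (Set Ω)}

lemma covNfull_le_card {n : ℕ} (W : Finset (Fin n → ↥U))
    (hW : ∀ x, ∃ w ∈ W, x ∈ cell T (fun i : ↥U => (i : Set Ω)) w) :
    covNfull (joinN T U n) ≤ W.card := by
  refine le_trans (Nat.sInf_le ⟨W.image (cell T fun i : ↥U => (i : Set Ω)), ?_, rfl, ?_⟩)
    Finset.card_image_le
  · intro A hA
    obtain ⟨w, -, rfl⟩ := Finset.mem_image.1 hA
    exact (mem_joinN T U n _).2 ⟨w, rfl⟩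
  · refine Set.eq_univ_of_forall fun x => ?_
    obtain ⟨w, hw, hx⟩ := hW x
    exact ⟨_, Finset.mem_coe.2 (Finset.mem_image_of_mem _ hw), hx⟩

variable (hU : ⋃₀ (U : Set (Set Ω)) = Set.univ)
include hU

lemma exists_minimal_words (n : ℕ) :
    ∃ W : Finset (Fin n → ↥U), W.card = covNfull (joinN T U n) ∧
      ∀ x, ∃ w ∈ W, x ∈ cell T (fun i : ↥U => (i : Set Ω)) w := by
  obtain ⟨f, hf⟩ := exists_label hU
  have hne : {m | ∃ W ⊆ joinN T U n, W.card = m ∧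
      ⋃₀ (W : Set (Set Ω)) = Set.univ}.Nonempty := by
    refine ⟨_, joinN T U n, le_rfl, rfl, Set.eq_univ_of_forall fun x => ?_⟩
    exact ⟨_, (mem_joinN T U n _).2 ⟨fun j => f (T^[j] x), rfl⟩, fun j => hf _⟩
  obtain ⟨W, hWs, hWc, hWu⟩ := Nat.sInf_mem hne
  have : ∀ A : ↥W, ∃ w : Fin n → ↥U, (A : Set Ω) = cell T (fun i : ↥U => (i : Set Ω)) w :=
    fun A => (mem_joinN T U n _).1 (hWs A.2)
  choose φ hφ using this
  have hcov : ∀ x, ∃ w ∈ Finset.univ.image φ, x ∈ cell T (fun i : ↥U => (i : Set Ω)) w := by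
    intro x
    obtain ⟨A, hA, hx⟩ : x ∈ ⋃₀ (W : Set (Set Ω)) := hWu ▸ Set.mem_univ x
    exact ⟨φ ⟨A, hA⟩, Finset.mem_image_of_mem _ (Finset.mem_univ _), hφ ⟨A, hA⟩ ▸ hx⟩
  refine ⟨_, le_antisymm ?_ (covNfull_le_card T _ hcov), hcov⟩
  refine Finset.card_image_le.trans ?_
  rw [Finset.card_univ, Fintype.card_coe, hWc]
  rfl

lemma covNfull_pos [Nonempty Ω] (n : ℕ) : 0 < covNfull (joinN T U n) := by
  obtain ⟨W, hc, hW⟩ := exists_minimal_words T hU n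
  obtain ⟨w, hw, -⟩ := hW (Classical.arbitrary Ω)
  rw [← hc]
  exact Finset.card_pos.2 ⟨w, hw⟩

lemma covNfull_add_le (m n : ℕ) : covNfull (joinN T U (m + n)) ≤
    covNfull (joinN T U m) * covNfull (joinN T U n) := by
  obtain ⟨W, hc, hW⟩ := exists_minimal_words T hU m
  obtain ⟨W', hc', hW'⟩ := exists_minimal_words T hU n
  rw [← hc, ← hc', ← Finset.card_product]
  refine (covNfull_le_card T ((W ×ˢ W').image fun p => Fin.append p.1 p.2) fun x => ?_).trans
    Finset.card_image_le
  obtain ⟨w, hw, hx⟩ := hW x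
  obtain ⟨w', hw', hx'⟩ := hW' (T^[m] x)
  refine ⟨_, Finset.mem_image_of_mem _ (Finset.mk_mem_product hw hw'), fun j => ?_⟩
  refine Fin.addCases (fun i => ?_) (fun i => ?_) j
  · simpa using hx i
  · have := hx' i
    rw [← Function.iterate_add_apply] at this
    simpa [add_comm] using this

/-- Existence of the topological entropy of a cover, as an infimum and a limit. -/
lemma exists_topEntropy [Nonempty Ω] : ∃ h : ℝ, 0 ≤ h ∧
    limUnder atTop (fun n : ℕ => Real.log (covNfull (joinN T U n)) / n) = h ∧
    Tendsto (fun n : ℕ => Real.log (covNfull (joinN T U n)) / n) atTop (𝓝 h) ∧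
    ∀ n : ℕ, n * h ≤ Real.log (covNfull (joinN T U n)) := by
  have hpos : ∀ n, (0 : ℝ) < covNfull (joinN T U n) := fun n => by
    exact_mod_cast covNfull_pos T hU n
  have hnn : ∀ n, 0 ≤ Real.log (covNfull (joinN T U n)) := fun n => Real.log_natCast_nonneg _
  have hsub : Subadditive fun n : ℕ => Real.log (covNfull (joinN T U n)) := fun m n => by
    rw [← Real.log_mul (hpos m).ne' (hpos n).ne']
    exact Real.log_le_log (hpos _) (by exact_mod_cast covNfull_add_le T hU m n)
  have hb : BddBelow (Set.range fun n : ℕ => Real.log (covNfull (joinN T U n)) / n) :=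
    ⟨0, by rintro _ ⟨n, rfl⟩; exact div_nonneg (hnn n) n.cast_nonneg⟩
  have ht := hsub.tendsto_lim hb
  refine ⟨hsub.lim, ?_, ht.limUnder_eq, ht, fun n => ?_⟩
  · exact ge_of_tendsto ht (Eventually.of_forall fun n => div_nonneg (hnn n) n.cast_nonneg)
  · rcases Nat.eq_zero_or_pos n with rfl | hn
    · simpa using hnn 0
    · have := hsub.lim_le_div hb hn.ne'
      rwa [le_div_iff₀ (by exact_mod_cast hn), mul_comm] at this

end Topological

end Covers

section UpperBound

lemma exists_small_measure_ne_zero {Ω : Type*} [TopologicalSpace Ω] [SecondCountableTopology Ω]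
    [MeasurableSpace Ω] [BorelSpace Ω] (μ : Measure Ω) [IsProbabilityMeasure μ]
    [μ.OuterRegular] (hμ : ∀ x, μ {x} = 0) {η : ℝ} (hη : 0 < η) :
    ∃ B, MeasurableSet B ∧ μ B ≠ 0 ∧ μ.real B ≤ η := by
  by_contra hcon
  push Not at hcon
  have h0 : μ Set.univ = 0 := by
    refine measure_null_of_locally_null _ fun x _ => ?_
    have hx : μ {x} < ENNReal.ofReal η := by rw [hμ]; simpa using hη
    obtain ⟨V, hxV, hV, hlt⟩ := Set.exists_isOpen_lt_of_lt {x} _ hx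
    refine ⟨V, mem_nhdsWithin_of_mem_nhds (hV.mem_nhds (hxV rfl)), ?_⟩
    by_contra hne
    have := hcon V hV.measurableSet hne
    rw [measureReal_def] at this
    exact absurd (ENNReal.toReal_le_of_le_ofReal hη.le hlt.le) (not_le.2 this)
  simp at h0

section Tower

variable {Ω : Type*}

/-- `k` is the first hitting time of `B` from `y`. -/
def FirstHit (T : Ω → Ω) (B : Set Ω) (k : ℕ) (y : Ω) : Prop :=
  T^[k] y ∈ B ∧ ∀ j < k, T^[j] y ∉ B

lemma FirstHit.unique {T : Ω → Ω} {B : Set Ω} {k l : ℕ} {y : Ω} (hk : FirstHit T B k y)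
    (hl : FirstHit T B l y) : k = l := by
  rcases lt_trichotomy k l with h | h | h
  · exact absurd hk.1 (hl.2 k h)
  · exact h
  · exact absurd hl.1 (hk.2 l h)

lemma FirstHit.iterate {T : Ω → Ω} {B : Set Ω} {k i : ℕ} {y : Ω} (hk : FirstHit T B k y)
    (hi : i ≤ k) : FirstHit T B (k - i) (T^[i] y) := by
  refine ⟨?_, fun j hj => ?_⟩
  · rw [← Function.iterate_add_apply, Nat.sub_add_cancel hi]; exact hk.1
  · rw [← Function.iterate_add_apply]; exact hk.2 _ (by omega)

lemma iterate_apply_symm_iterate (T : Ω ≃ Ω) (i : ℕ) (y : Ω) :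
    T^[i] (T.symm^[i] y) = y :=
  (Function.LeftInverse.iterate T.apply_symm_apply i) y

lemma symm_iterate_apply_iterate (T : Ω ≃ Ω) {i j : ℕ} (h : i ≤ j) (y : Ω) :
    T.symm^[i] (T^[j] y) = T^[j - i] y := by
  obtain ⟨k, rfl⟩ := Nat.exists_eq_add_of_le h
  rw [Function.iterate_add_apply, (Function.LeftInverse.iterate T.symm_apply_apply i)]
  simp

lemma iterate_apply_symm_iterate_of_le (T : Ω ≃ Ω) {i j : ℕ} (h : j ≤ i) (y : Ω) :
    T^[j] (T.symm^[i] y) = T.symm^[i - j] y := by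
  have := symm_iterate_apply_iterate T.symm h y
  simpa using this

/-- A Rokhlin tower of height `n` whose error set is controlled by a set `B` of positive measure. -/
lemma exists_tower [MeasurableSpace Ω] {μ : Measure Ω} [IsProbabilityMeasure μ] (T : Ω ≃ᵐ Ω)
    (hT : Ergodic T μ) {B : Set Ω} (hB : MeasurableSet B) (hB0 : μ B ≠ 0) {n : ℕ} (hn : 0 < n) :
    ∃ C, MeasurableSet C ∧ n * μ.real C ≤ 1 ∧
      μ.real {y | ∀ i < n, T.symm^[i] y ∉ C} ≤ n * μ.real B := by
  have hTs : MeasurePreserving T.symm μ μ := hT.toMeasurePreserving.symm T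
  have hit_meas : ∀ k, MeasurableSet {y | FirstHit T B k y} := fun k => by
    have : {y | FirstHit T B k y} = T^[k] ⁻¹' B ∩ ⋂ j ∈ Set.Iio k, T^[j] ⁻¹' Bᶜ := by
      ext y; simp [FirstHit]
    rw [this]
    exact ((T.measurable.iterate k) hB).inter (MeasurableSet.biInter (Set.to_countable _)
      fun j _ => (T.measurable.iterate j) hB.compl)
  let C : Set Ω := {y | ∃ k, FirstHit T B k y ∧ k % n = n - 1}
  have hC : MeasurableSet C := by
    have : C = ⋃ k ∈ {k : ℕ | k % n = n - 1}, {y | FirstHit T B k y} := by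
      ext y; simp [C, and_comm]
    rw [this]
    exact MeasurableSet.biUnion (Set.to_countable _) fun k _ => hit_meas k
  refine ⟨C, hC, ?_, ?_⟩
  · have hdisj : Pairwise (Function.onFun Disjoint fun i : Fin n => T.symm^[i] ⁻¹' C) := by
      intro i j hij
      refine Set.disjoint_left.2 fun y hi hj => hij (Fin.ext ?_)
      obtain ⟨k, hk, hkn⟩ := hi
      obtain ⟨l, hl, hln⟩ := hj
      have hik : (i : ℕ) ≤ k := by have := Nat.mod_le k n; omega
      have hjl : (j : ℕ) ≤ l := by have := Nat.mod_le l n; omega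
      have h1 := hk.iterate hik
      have h2 := hl.iterate hjl
      rw [show T^[i] (T.symm^[i] y) = y from iterate_apply_symm_iterate T.toEquiv _ _] at h1
      rw [show T^[j] (T.symm^[j] y) = y from iterate_apply_symm_iterate T.toEquiv _ _] at h2
      have h3 := h1.unique h2
      have h4 : (i : ℕ) + l ≡ j + l [MOD n] := by
        have : (i : ℕ) + l = j + k := by omega
        rw [this]
        exact Nat.ModEq.add_left _ (show k % n = l % n by omega)
      have h5 : (i : ℕ) % n = j % n := Nat.ModEq.add_right_cancel' _ h4
      rwa [Nat.mod_eq_of_lt i.2, Nat.mod_eq_of_lt j.2] at h5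
    have hsum := measureReal_iUnion_fintype (μ := μ) hdisj
      fun i => (T.symm.measurable.iterate i) hC
    have heq : ∀ i : Fin n, μ.real (T.symm^[i] ⁻¹' C) = μ.real C := fun i => by
      rw [measureReal_def, (hTs.iterate i).measure_preimage hC.nullMeasurableSet, measureReal_def]
    simp only [heq, Finset.sum_const, Finset.card_univ, Fintype.card_fin, nsmul_eq_mul] at hsum
    rw [← hsum]
    exact measureReal_le_one
  · let D : Set Ω := ⋃ k, T^[k] ⁻¹' B
    have hD : MeasurableSet D := MeasurableSet.iUnion fun k => (T.measurable.iterate k) hB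
    have hDc : μ Dᶜ = 0 := by
      have hsub : T ⁻¹' D ⊆ D := by
        intro y hy
        obtain ⟨k, hk⟩ := Set.mem_iUnion.1 hy
        exact Set.mem_iUnion.2 ⟨k + 1, by simpa using hk⟩
      rcases hT.ae_empty_or_univ_of_preimage_ae_le hD.nullMeasurableSet
        hsub.eventuallyLE with h | h
      · exfalso
        apply hB0
        refine measure_mono_null ?_ (ae_eq_empty.1 h)
        exact fun y hy => Set.mem_iUnion.2 ⟨0, hy⟩
      · exact ae_eq_univ.1 h
    have hsub : {y | ∀ i < n, T.symm^[i] y ∉ C} ⊆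
        Dᶜ ∪ ⋃ j ∈ Finset.range n, T.symm^[j] ⁻¹' B := by
      intro y hy
      by_cases hyD : y ∈ D
      swap
      · exact Or.inl hyD
      right
      have hex : ∃ k, T^[k] y ∈ B := by simpa [D] using hyD
      have hk : FirstHit T B (Nat.find hex) y :=
        ⟨Nat.find_spec hex, fun j hj => Nat.find_min hex hj⟩
      set k := Nat.find hex
      set i := n - 1 - k % n with hi
      have hkn := Nat.mod_lt k hn
      have hmod : (k + i) % n = n - 1 := by
        rw [Nat.add_mod, Nat.mod_eq_of_lt (show i < n by omega),
          Nat.mod_eq_of_lt (show k % n + i < n by omega)]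
        omega
      have hnot : ¬ FirstHit T B (k + i) (T.symm^[i] y) := fun h =>
        hy i (by omega) ⟨k + i, h, hmod⟩
      have hend : T^[k + i] (T.symm^[i] y) ∈ B := by
        rw [Function.iterate_add_apply,
          show T^[i] (T.symm^[i] y) = y from iterate_apply_symm_iterate T.toEquiv _ _]
        exact hk.1
      have : ∃ j < k + i, T^[j] (T.symm^[i] y) ∈ B := by
        by_contra hc
        push Not at hc
        exact hnot ⟨hend, hc⟩
      obtain ⟨j, hj, hjB⟩ := this
      rcases le_or_gt i j with hij | hij
      · exfalso
        obtain ⟨l, rfl⟩ := Nat.exists_eq_add_of_le' hij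
        rw [Function.iterate_add_apply,
          show T^[i] (T.symm^[i] y) = y from iterate_apply_symm_iterate T.toEquiv _ _] at hjB
        exact hk.2 l (by omega) hjB
      · rw [show T^[j] (T.symm^[i] y) = T.symm^[i - j] y from
          iterate_apply_symm_iterate_of_le T.toEquiv hij.le _] at hjB
        simp only [Set.mem_iUnion, Finset.mem_range]
        exact ⟨i - j, by omega, hjB⟩
    calc μ.real {y | ∀ i < n, T.symm^[i] y ∉ C}
        ≤ μ.real (Dᶜ ∪ ⋃ j ∈ Finset.range n, T.symm^[j] ⁻¹' B) := measureReal_mono hsub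
      _ ≤ μ.real Dᶜ + μ.real (⋃ j ∈ Finset.range n, T.symm^[j] ⁻¹' B) :=
        measureReal_union_le _ _
      _ = μ.real (⋃ j ∈ Finset.range n, T.symm^[j] ⁻¹' B) := by
        rw [measureReal_def, hDc]; simp
      _ ≤ ∑ j ∈ Finset.range n, μ.real (T.symm^[j] ⁻¹' B) :=
        measureReal_biUnion_finset_le _ _
      _ = ∑ j ∈ Finset.range n, μ.real B := Finset.sum_congr rfl fun j _ => by
        rw [measureReal_def, (hTs.iterate j).measure_preimage hB.nullMeasurableSet,
          measureReal_def]
      _ = n * μ.real B := by simp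

end Tower

lemma hPlusC_le_zero_of_atom {Ω : Type*} [MeasurableSpace Ω] [MeasurableSingletonClass Ω]
    {μ : Measure Ω} [IsProbabilityMeasure μ] (T : Ω ≃ᵐ Ω) (hT : Ergodic T μ)
    {U : Finset (Set Ω)} {g : Ω → ↥U} (hg : FibMeas g)
    (hgU : ∀ x, x ∈ (g x : Set Ω)) {x : Ω} (hx : μ {x} ≠ 0) : hPlusC μ T U ≤ 0 := by
  let O : Set Ω := {y | μ {y} = μ {x}}
  have hOc : O.Countable := by
    have := Measure.countable_meas_pos_of_disjoint_iUnion (μ := μ) (As := fun y : Ω => {y})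
      (fun y => measurableSet_singleton y)
      (fun a b hab => Set.disjoint_singleton.2 hab)
    refine this.mono fun y hy => ?_
    have hy' : μ {y} = μ {x} := hy
    change 0 < μ {y}
    rw [hy']
    exact pos_iff_ne_zero.2 hx
  have hO : MeasurableSet O := hOc.measurableSet
  have hinv : T ⁻¹' O = O := by
    ext y
    have : μ {T y} = μ {y} := by
      rw [← hT.measure_preimage (measurableSet_singleton (T y)).nullMeasurableSet]
      congr 1
      ext z; simp
    simp [O, this]
  have hO1 : μ Oᶜ = 0 := by
    rcases hT.toPreErgodic.measure_self_or_compl_eq_zero hO hinv with h | h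
    · exact absurd (measure_mono_null (Set.singleton_subset_iff.2 (show x ∈ O from rfl)) h) hx
    · exact h
  have hxr : 0 < μ.real {x} := ENNReal.toReal_pos hx (measure_ne_top _ _)
  have hent : ∀ n, shEnt μ (word T g n) ≤ -Real.log (μ.real {x}) := fun n => by
    refine shEnt_le_of_fiber μ (hg.word T.measurable n) fun w hw => neg_le_neg ?_
    obtain ⟨y, hyw, hyO⟩ : (word T g n ⁻¹' {w} ∩ O).Nonempty := by
      by_contra hne
      apply hw
      rw [measureReal_def, measure_mono_null (fun y hy hyO => hne ⟨y, hy, hyO⟩) hO1]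
      rfl
    refine Real.log_le_log hxr ?_
    rw [measureReal_def, ← show μ {y} = μ {x} from hyO, ← measureReal_def]
    exact measureReal_mono (Set.singleton_subset_iff.2 hyw)
  refine ge_of_tendsto (tendsto_const_div_atTop_nhds_zero_nat (-Real.log (μ.real {x}))) ?_
  filter_upwards [eventually_gt_atTop 0] with n hn
  exact (hPlusC_le hT.toMeasurePreserving hg hgU hn.ne').trans
    (div_le_div_of_nonneg_right (hent n) n.cast_nonneg)

/-- Decoding tower symbols: the block names carried by the bases determine the labels. -/
noncomputable def decode {κ ι : Type*} [Inhabited ι] {n : ℕ} (nm : κ → Fin n → ι)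
    (s : Fin n → Option (κ ⊕ ι)) : ι :=
  if h : ∃ p : Fin n × κ, s p.1 = some (Sum.inl p.2) then nm h.choose.2 h.choose.1
  else if h' : ∃ p : Fin n × ι, (p.1 : ℕ) = 0 ∧ s p.1 = some (Sum.inr p.2) then h'.choose.2
  else default

omit [MeasurableSpace X] in
lemma fibMeas_const_comp {Ω κ ι : Type*} [MeasurableSpace Ω] [Finite κ] {f : Ω → κ}
    (hf : FibMeas f) (φ : κ → ι) : FibMeas (φ ∘ f) := by
  intro k
  have : φ ∘ f ⁻¹' {k} = ⋃ a ∈ {a | φ a = k}, f ⁻¹' {a} := by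
    ext x; simp
  rw [this]
  exact MeasurableSet.biUnion (Set.toFinite _).countable fun a _ => hf a

/-- The entropy of a cover is at most the Shannon entropy of the symbols of a tower. -/
lemma hPlusC_le_tower {Ω : Type*} [MeasurableSpace Ω] {μ : Measure Ω} [IsProbabilityMeasure μ]
    (T : Ω ≃ᵐ Ω) (hT : MeasurePreserving T μ μ) {U : Finset (Set Ω)} {κ : Type*} [Fintype κ]
    {n : ℕ} (hn : 0 < n) (nm : κ → Fin n → ↥U) {v : Ω → κ} (hv : FibMeas v)
    (hvU : ∀ x, x ∈ cell T (fun i : ↥U => (i : Set Ω)) (nm (v x)))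
    {g : Ω → ↥U} (hg : FibMeas g) (hgU : ∀ x, x ∈ (g x : Set Ω))
    {C E : Set Ω} (hC : MeasurableSet C) (hE : E = {y | ∀ i < n, T.symm^[i] y ∉ C}) :
    hPlusC μ T U ≤ shEnt μ (fun y =>
      if y ∈ C then some (Sum.inl (v y)) else if y ∈ E then some (Sum.inr (g y)) else none) := by
  obtain ⟨x₀⟩ : Nonempty Ω := nonempty_of_isProbabilityMeasure μ
  have : Inhabited ↥U := ⟨g x₀⟩
  have hEm : MeasurableSet E := by
    have : E = ⋂ i ∈ Set.Iio n, T.symm^[i] ⁻¹' Cᶜ := by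
      rw [hE]; ext y; simp
    rw [this]
    exact MeasurableSet.biInter (Set.to_countable _)
      fun i _ => (T.symm.measurable.iterate i) hC.compl
  set σ : Ω → Option (κ ⊕ ↥U) := fun y =>
      if y ∈ C then some (Sum.inl (v y)) else if y ∈ E then some (Sum.inr (g y)) else none
    with hσdef
  have hσ : FibMeas σ := by
    have h1 : FibMeas fun y => (decide (y ∈ C), decide (y ∈ E), v y, g y) := by
      have hd : ∀ S : Set Ω, MeasurableSet S → FibMeas fun y => decide (y ∈ S) := by
        intro S hS b
        cases b
        · convert hS.compl using 1; ext y; simp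
        · convert hS using 1; ext y; simp
      exact (hd C hC).prodMk ((hd E hEm).prodMk (hv.prodMk hg))
    have h2 := fibMeas_const_comp h1 fun p => if p.1 then some (Sum.inl p.2.2.1)
      else if p.2.1 then some (Sum.inr p.2.2.2) else none
    simpa only [Function.comp_def, decide_eq_true_eq] using h2
  let f : Ω → ↥U := decode nm ∘ word T.symm σ n
  have hf : FibMeas f := fibMeas_const_comp (hσ.word T.symm.measurable n) _
  have hfU : ∀ y, y ∈ (f y : Set Ω) := by
    intro y
    simp only [f, Function.comp_apply, decode]
    split_ifs with h h'
    · have hs := h.choose_spec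
      set i := h.choose.1
      set w := h.choose.2
      have hs' : v (T.symm^[i] y) = w := by
        simp only [word, σ] at hs
        split_ifs at hs
        · simpa using hs
        · simp at hs
      have := hvU (T.symm^[i] y) i
      rw [hs', show T^[i] (T.symm^[i] y) = y from iterate_apply_symm_iterate T.toEquiv _ _] at this
      exact this
    · have hs := h'.choose_spec
      set i := h'.choose.1
      set w := h'.choose.2
      have : g y = w := by
        have h2 := hs.2
        simp only [word, σ, hs.1, Function.iterate_zero, id] at h2
        split_ifs at h2
        · simp at h2
        · simpa using h2
      exact this ▸ hgU y
    · exfalso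
      have hyE : y ∈ E := by
        rw [hE]
        intro i hi hC'
        exact h ⟨(⟨i, hi⟩, v (T.symm^[i] y)), by simp [word, σ, hC']⟩
      refine h' ⟨(⟨0, hn⟩, g y), rfl, ?_⟩
      have hyC : y ∉ C := by
        rw [hE] at hyE; exact hyE 0 hn
      simp [word, σ, hyC, hyE]
  have hbound : ∀ m : ℕ, shEnt μ (word T f m) ≤ (m + n : ℕ) * shEnt μ σ := by
    intro m
    rw [← shEnt_comp_eq (hf.word T.measurable m) (hT.iterate n)]
    refine le_trans ?_ (shEnt_word_le_mul hT hσ (m + n))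
    refine shEnt_mono μ ((hf.word T.measurable m).comp (T.measurable.iterate n))
      (hσ.word T.measurable _) fun x y hxy => funext fun j => ?_
    simp only [word, Function.comp_apply, f]
    congr 1
    funext i
    simp only [← Function.iterate_add_apply]
    have e : ∀ z, T.symm^[i] (T^[(j : ℕ) + n] z) = T^[(j : ℕ) + n - i] z := fun z =>
      symm_iterate_apply_iterate T.toEquiv (by omega) z
    change σ (T.symm^[i] (T^[(j : ℕ) + n] x)) = σ (T.symm^[i] (T^[(j : ℕ) + n] y))
    rw [e, e]
    exact congrFun hxy ⟨j + n - i, by omega⟩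
  by_contra hlt
  push Not at hlt
  obtain ⟨m, hm⟩ := exists_nat_gt (n * shEnt μ σ / (hPlusC μ T U - shEnt μ σ))
  have hpos : 0 < hPlusC μ T U - shEnt μ σ := sub_pos.2 hlt
  rw [div_lt_iff₀ hpos] at hm
  have hm0 : m ≠ 0 := by
    rintro rfl
    have := mul_nonneg n.cast_nonneg (shEnt_nonneg μ σ) (α := ℝ)
    simp only [Nat.cast_zero, zero_mul] at hm
    linarith
  have h1 := hPlusC_le hT hf hfU hm0
  rw [le_div_iff₀ (by positivity)] at h1
  have h2 := hbound m
  push_cast at h2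
  linarith

end UpperBound

section UpperBoundErgodic

lemma shEnt_tower_le {Ω : Type*} [MeasurableSpace Ω] {μ : Measure Ω} [IsProbabilityMeasure μ]
    {κ ι : Type*} [Fintype κ] [Fintype ι] [Nonempty κ] [Nonempty ι] {v : Ω → κ} (hv : FibMeas v)
    {g : Ω → ι} (hg : FibMeas g) {C E : Set Ω} (hC : MeasurableSet C) (hE : MeasurableSet E)
    (hCE : Disjoint C E) {n : ℕ} (hn : 3 ≤ n) (hCn : n * μ.real C ≤ 1) :
    shEnt μ (fun y =>
      if y ∈ C then some (Sum.inl (v y)) else if y ∈ E then some (Sum.inr (g y)) else none) ≤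
      -Real.log (1 - 2 / n) + (Real.log n + Real.log (Fintype.card κ)) / n
        + μ.real E * (Real.log n + Real.log (Fintype.card ι)) := by
  set σ : Ω → Option (κ ⊕ ι) := fun y =>
      if y ∈ C then some (Sum.inl (v y)) else if y ∈ E then some (Sum.inr (g y)) else none
    with hσdef
  have hn3 : (3 : ℝ) ≤ n := by exact_mod_cast hn
  have hn0 : (0 : ℝ) < n := by linarith
  have hκ : (0 : ℝ) < Fintype.card κ := by exact_mod_cast Fintype.card_pos
  have hι : (0 : ℝ) < Fintype.card ι := by exact_mod_cast Fintype.card_pos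
  have hκ1 : (1 : ℝ) ≤ Fintype.card κ := by exact_mod_cast Fintype.card_pos
  have hι1 : (1 : ℝ) ≤ Fintype.card ι := by exact_mod_cast Fintype.card_pos
  have hfl : ∀ a, σ ⁻¹' {some (Sum.inl a)} = C ∩ v ⁻¹' {a} := by
    intro a; ext y
    by_cases h1 : y ∈ C <;> by_cases h2 : y ∈ E <;> simp [σ, h1, h2]
  have hfr : ∀ a, σ ⁻¹' {some (Sum.inr a)} = E ∩ g ⁻¹' {a} := by
    intro a; ext y
    by_cases h1 : y ∈ C
    · have h2 : y ∉ E := Set.disjoint_left.1 hCE h1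
      simp [σ, h1, h2]
    · by_cases h2 : y ∈ E <;> simp [σ, h1, h2]
  have hfn : σ ⁻¹' {none} = (C ∪ E)ᶜ := by
    ext y
    by_cases h1 : y ∈ C <;> by_cases h2 : y ∈ E <;> simp [σ, h1, h2]
  have hσ : FibMeas σ := by
    rintro (_ | a | a)
    · rw [hfn]; exact (hC.union hE).compl
    · rw [hfl]; exact hC.inter (hv a)
    · rw [hfr]; exact hE.inter (hg a)
  have h2n : 2 / (n : ℝ) < 1 := by rw [div_lt_one hn0]; linarith
  let q : Option (κ ⊕ ι) → ℝ := fun s => s.elim (1 - 2 / n)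
    (Sum.elim (fun _ => (n * Fintype.card κ : ℝ)⁻¹) fun _ => (n * Fintype.card ι : ℝ)⁻¹)
  have hq : ∀ s, 0 < q s := by
    rintro (_ | a | a)
    · simp only [q, Option.elim]; linarith
    · simp only [q, Option.elim, Sum.elim_inl]; positivity
    · simp only [q, Option.elim, Sum.elim_inr]; positivity
  have hq1 : ∑ s, q s = 1 := by
    simp only [q, Fintype.sum_option, Fintype.sum_sum_type, Option.elim, Sum.elim_inl,
      Sum.elim_inr, Finset.sum_const, Finset.card_univ, nsmul_eq_mul]
    field_simp
    ring
  have hmain := sum_negMulLog_le (p := fun s => μ.real (σ ⁻¹' {s})) (q := q)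
    (fun _ => measureReal_nonneg) (fun s => (hq s).le) (fun s h => absurd h (hq s).ne')
    (sum_measureReal_fiber μ hσ) hq1.le
  refine hmain.trans ?_
  rw [Fintype.sum_option, Fintype.sum_sum_type]
  simp only [q, Option.elim, Sum.elim_inl, Sum.elim_inr, hfl, hfr]
  rw [← Finset.sum_mul, ← Finset.sum_mul, sum_measureReal_inter_fiber μ hv hC,
    sum_measureReal_inter_fiber μ hg hE, Real.log_inv, Real.log_inv, neg_neg, neg_neg,
    Real.log_mul hn0.ne' hκ.ne', Real.log_mul hn0.ne' hι.ne', add_assoc]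
  refine add_le_add ?_ (add_le_add ?_ le_rfl)
  · have : 0 ≤ -Real.log (1 - 2 / n) := by
      rw [neg_nonneg]
      refine Real.log_nonpos (by linarith) ?_
      have : 0 < 2 / (n : ℝ) := by positivity
      linarith
    exact mul_le_of_le_one_left this measureReal_le_one
  · have hl : 0 ≤ Real.log n + Real.log (Fintype.card κ) :=
      add_nonneg (Real.log_nonneg (by linarith)) (Real.log_nonneg hκ1)
    rw [div_eq_inv_mul]
    refine mul_le_mul_of_nonneg_right ?_ hl
    rw [← one_div, le_div_iff₀ hn0]
    linarith

lemma hPlusC_le_topEntropy {Ω : Type*} [TopologicalSpace Ω] [SecondCountableTopology Ω] [T1Space Ω]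
    [MeasurableSpace Ω] [BorelSpace Ω] {μ : Measure Ω} [IsProbabilityMeasure μ] [μ.OuterRegular]
    (T : Ω ≃ᵐ Ω) (hT : Ergodic T μ) {U : Finset (Set Ω)} (hU : IsMCover U) {h : ℝ} (h0 : 0 ≤ h)
    (hlim : Tendsto (fun n : ℕ => Real.log (covNfull (joinN T U n)) / n) atTop (𝓝 h)) :
    hPlusC μ T U ≤ h := by
  obtain ⟨x₀⟩ : Nonempty Ω := nonempty_of_isProbabilityMeasure μ
  obtain ⟨f₀, hf₀⟩ := exists_label hU.2
  have : Nonempty ↥U := ⟨f₀ x₀⟩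
  obtain ⟨g, hg, hgU⟩ := exists_fibMeas_label (V := fun i : ↥U => (i : Set Ω))
    (fun i => hU.1 _ i.2) fun x => ⟨f₀ x, hf₀ x⟩
  by_cases hatom : ∃ x, μ {x} ≠ 0
  · obtain ⟨x, hx⟩ := hatom
    exact (hPlusC_le_zero_of_atom T hT hg hgU hx).trans h0
  push Not at hatom
  have key : ∀ n : ℕ, 3 ≤ n → hPlusC μ T U ≤ -Real.log (1 - 2 / n) +
      (Real.log n / n + Real.log (covNfull (joinN T U n)) / n) + 1 / n := by
    intro n hn
    have hn0 : (0 : ℝ) < n := by exact_mod_cast (show 0 < n by omega)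
    obtain ⟨W, hWc, hW⟩ := exists_minimal_words T hU.2 n
    have hWne : Nonempty ↥W := by
      obtain ⟨w, hw, -⟩ := hW x₀
      exact ⟨⟨w, hw⟩⟩
    obtain ⟨v, hv, hvU⟩ := exists_fibMeas_label
      (V := fun w : ↥W => cell T (fun i : ↥U => (i : Set Ω)) (w : Fin n → ↥U))
      (fun w => by
        have : cell T (fun i : ↥U => (i : Set Ω)) (w : Fin n → ↥U) =
            ⋂ j : Fin n, T^[j] ⁻¹' ((w : Fin n → ↥U) j : Set Ω) := by
          ext x; simp [cell]
        rw [this]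
        exact MeasurableSet.iInter fun j => (T.measurable.iterate j) (hU.1 _ (Subtype.prop _)))
      (fun x => by
        obtain ⟨w, hw, hx⟩ := hW x
        exact ⟨⟨w, hw⟩, hx⟩)
    set L := Real.log n + Real.log (Fintype.card ↥U) with hL
    have hL0 : 0 ≤ L := add_nonneg (Real.log_natCast_nonneg _) (Real.log_natCast_nonneg _)
    obtain ⟨B, hB, hB0, hBη⟩ := exists_small_measure_ne_zero μ hatom
      (η := 1 / (n ^ 2 * (L + 1))) (by positivity)
    obtain ⟨C, hC, hCn, hE⟩ := exists_tower T hT hB hB0 (show 0 < n by omega)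
    have hEm : MeasurableSet {y | ∀ i < n, T.symm^[i] y ∉ C} := by
      have : {y | ∀ i < n, T.symm^[i] y ∉ C} = ⋂ i ∈ Set.Iio n, T.symm^[i] ⁻¹' Cᶜ := by
        ext y; simp
      rw [this]
      exact MeasurableSet.biInter (Set.to_countable _)
        fun i _ => (T.symm.measurable.iterate i) hC.compl
    have h1 := hPlusC_le_tower T hT.toMeasurePreserving (show 0 < n by omega)
      (fun w : ↥W => (w : Fin n → ↥U)) hv hvU hg hgU hC rfl
    refine h1.trans ((shEnt_tower_le hv hg hC hEm (Set.disjoint_left.2 fun y hy hyE =>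
      hyE 0 (by omega) hy) hn hCn).trans ?_)
    rw [Fintype.card_coe, hWc, add_div]
    refine add_le_add le_rfl ?_
    calc μ.real {y | ∀ i < n, T.symm^[i] y ∉ C} * L
        ≤ (n * (1 / (n ^ 2 * (L + 1)))) * L := by
          refine mul_le_mul_of_nonneg_right (hE.trans ?_) hL0
          exact mul_le_mul_of_nonneg_left hBη hn0.le
      _ = 1 / n * (L / (L + 1)) := by field_simp
      _ ≤ 1 / n * 1 := by
          refine mul_le_mul_of_nonneg_left ?_ (by positivity)
          rw [div_le_one (by linarith)]; linarith
      _ = 1 / n := mul_one _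
  have hlim2 : Tendsto (fun n : ℕ => -Real.log (1 - 2 / n) +
      (Real.log n / n + Real.log (covNfull (joinN T U n)) / n) + 1 / n) atTop
      (𝓝 (-Real.log (1 - 0) + (0 + h) + 0)) := by
    have t1 : Tendsto (fun n : ℕ => (2 : ℝ) / n) atTop (𝓝 0) :=
      tendsto_const_div_atTop_nhds_zero_nat 2
    have t2 : Tendsto (fun n : ℕ => Real.log n / n) atTop (𝓝 0) := by
      have := Real.isLittleO_log_id_atTop.tendsto_div_nhds_zero
      exact this.comp tendsto_natCast_atTop_atTop
    have t3 : Tendsto (fun n : ℕ => (1 : ℝ) / n) atTop (𝓝 0) :=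
      tendsto_const_div_atTop_nhds_zero_nat 1
    refine Tendsto.add (Tendsto.add (Tendsto.neg ?_) (t2.add hlim)) t3
    exact (Real.continuousAt_log (by norm_num)).tendsto.comp (tendsto_const_nhds.sub t1)
  have := ge_of_tendsto hlim2 ((eventually_ge_atTop 3).mono key)
  simpa using this

end UpperBoundErgodic

section ZeroDimensional

/-- Every topological dynamical system is a factor of a zero-dimensional one. -/
lemma exists_zeroDimensional_extension {Y : Type*} [MetricSpace Y] [CompactSpace Y] [Nonempty Y]
    {T : Y → Y} (hT : Continuous T) :
    ∃ (Z : Type) (_ : TopologicalSpace Z) (_ : CompactSpace Z)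
      (_ : TopologicalSpace.MetrizableSpace Z) (_ : TotallyDisconnectedSpace Z)
      (R : Z → Z) (π : Z → Y), Continuous R ∧ Continuous π ∧ Function.Surjective π ∧
        Function.Semiconj π R T := by
  obtain ⟨p, hp, hps⟩ := exists_nat_bool_continuous_surjective_of_compact Y
  let S : Set (ℕ → ℕ → Bool) := {z | ∀ i, p (z (i + 1)) = T (p (z i))}
  have hS : IsClosed S := by
    have : S = ⋂ i, {z | p (z (i + 1)) = T (p (z i))} := by ext z; simp [S]
    rw [this]
    exact isClosed_iInter fun i => isClosed_eq (hp.comp (continuous_apply _))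
      (hT.comp (hp.comp (continuous_apply _)))
  refine ⟨S, inferInstance, isCompact_iff_compactSpace.1 hS.isCompact, inferInstance,
    inferInstance, fun z => ⟨fun i => z.1 (i + 1), fun i => z.2 (i + 1)⟩, fun z => p (z.1 0),
    ?_, ?_, ?_, ?_⟩
  · refine Continuous.subtype_mk ?_ _
    exact continuous_pi fun i => (continuous_apply (i + 1)).comp continuous_subtype_val
  · exact hp.comp ((continuous_apply 0).comp continuous_subtype_val)
  · intro y
    choose s hs using hps
    refine ⟨⟨fun i => s (T^[i] y), fun i => ?_⟩, hs y⟩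
    simp only [hs, Function.iterate_succ_apply']
  · intro z
    exact z.2 0

variable {Z ι : Type*} [TopologicalSpace Z] [CompactSpace Z] [T2Space Z]
  [TotallyDisconnectedSpace Z]

/-- All fibres of the labelling are clopen. -/
def ClopenFib {Z ι : Type*} [TopologicalSpace Z] (f : Z → ι) : Prop :=
  ∀ i, IsClopen (f ⁻¹' {i})

omit [CompactSpace Z] [T2Space Z] [TotallyDisconnectedSpace Z] in
lemma ClopenFib.fibMeas [MeasurableSpace Z] [BorelSpace Z] {f : Z → ι} (hf : ClopenFib f) :
    FibMeas f :=
  fun i => (hf i).isClosed.measurableSet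

omit [CompactSpace Z] [T2Space Z] [TotallyDisconnectedSpace Z] in
lemma ClopenFib.word {f : Z → ι} (hf : ClopenFib f) {R : Z → Z} (hR : Continuous R) (n : ℕ) :
    ClopenFib (word R f n) := fun w => by
  rw [word_preimage]
  exact isClopen_iInter_of_finite fun j => (hf _).preimage (hR.iterate _)

/-- An open cover of a zero-dimensional compact space has a subordinate clopen labelling. -/
lemma exists_clopenFib_label [Nonempty ι] {O : ι → Set Z} (hO : ∀ i, IsOpen (O i))
    (hcov : ∀ z, ∃ i, z ∈ O i) : ∃ f : Z → ι, ClopenFib f ∧ ∀ z, z ∈ O (f z) := by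
  have key : ∃ C : Set Z, IsClopen C ∧ Set.univ ⊆ C ∧
      ∃ f : Z → ι, ClopenFib f ∧ ∀ z ∈ C, z ∈ O (f z) := by
    refine isCompact_univ.induction_on (p := fun s => ∃ C : Set Z, IsClopen C ∧ s ⊆ C ∧
      ∃ f : Z → ι, ClopenFib f ∧ ∀ z ∈ C, z ∈ O (f z)) ?_ ?_ ?_ ?_
    · refine ⟨∅, isClopen_empty, le_rfl, fun _ => Classical.arbitrary ι, fun i => ?_, by simp⟩
      by_cases h : Classical.arbitrary ι = i
      · simpa [h] using isClopen_univ
      · simpa [h] using isClopen_empty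
    · rintro s t hst ⟨C, hC, htC, hf⟩
      exact ⟨C, hC, hst.trans htC, hf⟩
    · rintro s t ⟨C, hC, hsC, f, hf, hfC⟩ ⟨D, hD, htD, g, hg, hgD⟩
      refine ⟨C ∪ D, hC.union hD, Set.union_subset_union hsC htD, C.piecewise f g,
        fun i => ?_, ?_⟩
      · rw [Set.piecewise_preimage, Set.ite]
        exact ((hf i).inter hC).union ((hg i).diff hC)
      · intro z hz
        by_cases hzC : z ∈ C
        · rw [Set.piecewise_eq_of_mem _ _ _ hzC]; exact hfC z hzC
        · rw [Set.piecewise_eq_of_notMem _ _ _ hzC]; exact hgD z (hz.resolve_left hzC)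
    · intro z _
      obtain ⟨i, hi⟩ := hcov z
      obtain ⟨C, hC, hzC, hCi⟩ := compact_exists_isClopen_in_isOpen (hO i) hi
      refine ⟨C, mem_nhdsWithin_of_mem_nhds (hC.isOpen.mem_nhds hzC), C, hC, le_rfl,
        fun _ => i, fun j => ?_, hCi⟩
      by_cases h : i = j
      · simpa [h] using isClopen_univ
      · simpa [h] using isClopen_empty
  obtain ⟨C, -, hC, f, hf, hfC⟩ := key
  exact ⟨f, hf, fun z => hfC z (hC trivial)⟩

variable [MeasurableSpace Z] [BorelSpace Z]

/-- Measurable labellings subordinate to an open cover are approximated by clopen ones. -/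
lemma exists_clopenFib_approx [Fintype ι] [Nonempty ι] (ν : Measure Z) [IsFiniteMeasure ν]
    [ν.InnerRegularCompactLTTop]
    {V : ι → Set Z} (hV : ∀ i, IsOpen (V i)) {g : Z → ι} (hg : FibMeas g)
    (hgV : ∀ z, z ∈ V (g z)) {ε : ℝ} (hε : 0 < ε) :
    ∃ f : Z → ι, ClopenFib f ∧ (∀ z, z ∈ V (f z)) ∧ ν.real {z | f z ≠ g z} ≤ ε := by
  set δ := ε / Fintype.card ι with hδ
  have hc : (0 : ℝ) < Fintype.card ι := by exact_mod_cast Fintype.card_pos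
  have hδ0 : 0 < δ := div_pos hε hc
  have hK : ∀ i, ∃ K ⊆ g ⁻¹' {i}, IsCompact K ∧ ν.real (g ⁻¹' {i} \ K) ≤ δ := fun i => by
    obtain ⟨K, hKs, hKc, hK⟩ := (hg i).exists_isCompact_sdiff_lt (μ := ν) (measure_ne_top _ _)
      (ε := ENNReal.ofReal δ) (by simpa using hδ0)
    exact ⟨K, hKs, hKc, ENNReal.toReal_le_of_le_ofReal hδ0.le hK.le⟩
  choose K hKg hKc hKδ using hK
  obtain ⟨f, hf, hfO⟩ := exists_clopenFib_label
    (O := fun i => V i \ ⋃ j ∈ ({i}ᶜ : Set ι), K j)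
    (fun i => (hV i).sdiff
      ((Set.toFinite _).isClosed_biUnion fun j _ => (hKc j).isClosed))
    (fun z => ⟨g z, hgV z, by
      simp only [Set.mem_iUnion, not_exists]
      intro j hj hz
      exact hj (hKg j hz).symm⟩)
  refine ⟨f, hf, fun z => (hfO z).1, ?_⟩
  have hsub : {z | f z ≠ g z} ⊆ ⋃ i, (g ⁻¹' {i} \ K i) := by
    intro z hz
    refine Set.mem_iUnion.2 ⟨g z, rfl, fun hzK => (hfO z).2 ?_⟩
    exact Set.mem_biUnion (show g z ∈ ({f z}ᶜ : Set ι) from fun h => hz h.symm) hzK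
  calc ν.real {z | f z ≠ g z} ≤ ν.real (⋃ i, (g ⁻¹' {i} \ K i)) := measureReal_mono hsub
    _ ≤ ∑ i, ν.real (g ⁻¹' {i} \ K i) := measureReal_iUnion_fintype_le _
    _ ≤ ∑ _i : ι, δ := Finset.sum_le_sum fun i _ => hKδ i
    _ = ε := by rw [Finset.sum_const, Finset.card_univ, nsmul_eq_mul, hδ]; field_simp

omit [TopologicalSpace Z] [CompactSpace Z] [T2Space Z] [TotallyDisconnectedSpace Z]
  [BorelSpace Z] in
lemma abs_measureReal_word_sub_le {ν : Measure Z} [IsProbabilityMeasure ν] {R : Z → Z}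
    (hR : MeasurePreserving R ν ν) {f g : Z → ι} {ε : ℝ}
    (hN : MeasurableSet {z | f z ≠ g z}) (hε : ν.real {z | f z ≠ g z} ≤ ε) (m : ℕ)
    (w : Fin m → ι) :
    |ν.real (word R f m ⁻¹' {w}) - ν.real (word R g m ⁻¹' {w})| ≤ m * ε := by
  have hbad : ν.real (⋃ j : Fin m, R^[j] ⁻¹' {z | f z ≠ g z}) ≤ m * ε := by
    refine (measureReal_iUnion_fintype_le _).trans ?_
    calc _ ≤ ∑ _j : Fin m, ε := Finset.sum_le_sum fun j _ => by
          rwa [measureReal_def, (hR.iterate j).measure_preimage hN.nullMeasurableSet,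
            ← measureReal_def]
      _ = m * ε := by simp
  have aux : ∀ f' g' : Z → ι, {z | f' z ≠ g' z} = {z | f z ≠ g z} →
      ν.real (word R f' m ⁻¹' {w}) ≤ ν.real (word R g' m ⁻¹' {w}) + m * ε := by
    intro f' g' h
    refine le_trans (measureReal_mono (s₂ := word R g' m ⁻¹' {w} ∪
      ⋃ j : Fin m, R^[j] ⁻¹' {z | f z ≠ g z}) ?_) ((measureReal_union_le _ _).trans ?_)
    · intro z hz
      by_cases hbad : ∃ j : Fin m, R^[j] z ∈ {z | f z ≠ g z}
      · exact Or.inr (Set.mem_iUnion.2 hbad)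
      · left
        rw [← h] at hbad
        simp only [Set.mem_ofPred_eq, not_exists, not_not] at hbad
        rw [Set.mem_preimage, Set.mem_singleton_iff] at hz ⊢
        rw [← hz]
        exact funext fun j => (hbad j).symm
    · linarith
  rw [abs_sub_le_iff]
  constructor
  · linarith [aux f g rfl]
  · linarith [aux g f (by ext z; simp [eq_comm])]

/-- Lower entropy bounds pass from clopen to measurable subordinate labellings. -/
lemma le_shEnt_word_of_clopenFib [Fintype ι] [Nonempty ι] {ν : Measure Z}
    [IsProbabilityMeasure ν] [ν.InnerRegularCompactLTTop] {R : Z → Z}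
    (hR : MeasurePreserving R ν ν)
    {V : ι → Set Z} (hV : ∀ i, IsOpen (V i)) {c : ℝ} {m : ℕ}
    (h : ∀ f : Z → ι, ClopenFib f → (∀ z, z ∈ V (f z)) → c ≤ shEnt ν (word R f m))
    {g : Z → ι} (hg : FibMeas g) (hgV : ∀ z, z ∈ V (g z)) : c ≤ shEnt ν (word R g m) := by
  choose! f hf hfV hfε using fun k : ℕ =>
    exists_clopenFib_approx ν hV hg hgV (Nat.one_div_pos_of_nat (α := ℝ) (n := k))
  have hN : ∀ k, MeasurableSet {z | f k z ≠ g z} := fun k => by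
    have : {z | f k z ≠ g z} = ⋃ i, (f k ⁻¹' {i} \ g ⁻¹' {i}) := by
      ext z; simp [eq_comm]
    rw [this]
    exact MeasurableSet.iUnion fun i => ((hf k).fibMeas i).diff (hg i)
  refine ge_of_tendsto' (f := fun k => shEnt ν (word R (f k) m)) (x := atTop) ?_
    fun k => h _ (hf k) (hfV k)
  refine tendsto_finsetSum _ fun w _ => (Real.continuous_negMulLog.tendsto _).comp ?_
  rw [tendsto_iff_norm_sub_tendsto_zero]
  refine squeeze_zero (fun _ => norm_nonneg _)
    (fun k => abs_measureReal_word_sub_le hR (hN k) (hfε k) m w) ?_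
  simpa using tendsto_one_div_add_atTop_nhds_zero_nat.const_mul (m : ℝ)

end ZeroDimensional

section Averages

variable {Ω κ : Type*} [MeasurableSpace Ω] [Fintype κ]

/-- The average of the first `n` push-forwards of a measure. -/
noncomputable def orbitAverage {Ω : Type*} [MeasurableSpace Ω] (R : Ω → Ω) (ν : Measure Ω)
    (n : ℕ) : Measure Ω :=
  (n : ENNReal)⁻¹ • ∑ i ∈ Finset.range n, ν.map R^[i]

lemma isProbabilityMeasure_orbitAverage {R : Ω → Ω} (hR : Measurable R) (ν : Measure Ω)
    [IsProbabilityMeasure ν] {n : ℕ} (hn : n ≠ 0) :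
    IsProbabilityMeasure (orbitAverage R ν n) := by
  constructor
  have : ∀ i ∈ Finset.range n, ν.map R^[i] Set.univ = 1 := fun i _ => by
    rw [Measure.map_apply (hR.iterate i) MeasurableSet.univ, Set.preimage_univ, measure_univ]
  simp only [orbitAverage, Measure.smul_apply, Measure.coe_finsetSum, Finset.sum_apply,
    smul_eq_mul]
  rw [Finset.sum_congr rfl this, Finset.sum_const, Finset.card_range, nsmul_eq_mul, mul_one,
    ENNReal.inv_mul_cancel (by exact_mod_cast hn) (ENNReal.natCast_ne_top n)]

lemma orbitAverage_real {R : Ω → Ω} (hR : Measurable R) (ν : Measure Ω)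
    [IsProbabilityMeasure ν] (n : ℕ) {S : Set Ω} (hS : MeasurableSet S) :
    (orbitAverage R ν n).real S = (n : ℝ)⁻¹ * ∑ i ∈ Finset.range n, ν.real (R^[i] ⁻¹' S) := by
  simp only [measureReal_def, orbitAverage, Measure.smul_apply, Measure.coe_finsetSum,
    Finset.sum_apply, smul_eq_mul, ENNReal.toReal_mul, ENNReal.toReal_inv, ENNReal.toReal_natCast]
  rw [Finset.sum_congr rfl fun i _ => Measure.map_apply (hR.iterate i) hS,
    ENNReal.toReal_sum fun i _ => measure_ne_top _ _]

lemma abs_orbitAverage_preimage_sub_le {R : Ω → Ω} (hR : Measurable R) (ν : Measure Ω)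
    [IsProbabilityMeasure ν] (n : ℕ) {S : Set Ω} (hS : MeasurableSet S) :
    |(orbitAverage R ν n).real (R ⁻¹' S) - (orbitAverage R ν n).real S| ≤ (n : ℝ)⁻¹ := by
  rw [orbitAverage_real hR ν n hS, orbitAverage_real hR ν n (hR hS), ← mul_sub,
    ← Finset.sum_sub_distrib]
  have : ∀ i ∈ Finset.range n, ν.real (R^[i] ⁻¹' (R ⁻¹' S)) - ν.real (R^[i] ⁻¹' S) =
      ν.real (R^[i + 1] ⁻¹' S) - ν.real (R^[i] ⁻¹' S) := fun i _ => by
    rw [← Set.preimage_comp, ← Function.iterate_succ']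
  rw [Finset.sum_congr rfl this, Finset.sum_range_sub (fun i => ν.real (R^[i] ⁻¹' S)), abs_mul,
    abs_of_nonneg (by positivity : (0 : ℝ) ≤ (n : ℝ)⁻¹)]
  refine mul_le_of_le_one_right (by positivity) ?_
  have h0 : ∀ S, 0 ≤ ν.real S := fun _ => measureReal_nonneg
  have h1 : ∀ S, ν.real S ≤ 1 := fun _ => measureReal_le_one
  rw [abs_sub_le_iff]
  constructor <;> linarith [h0 (R^[n] ⁻¹' S), h0 (R^[0] ⁻¹' S), h1 (R^[n] ⁻¹' S),
    h1 (R^[0] ⁻¹' S)]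

lemma sum_shEnt_comp_iterate_le {R : Ω → Ω} (hR : Measurable R) (ν : Measure Ω)
    [IsProbabilityMeasure ν] {n : ℕ} (hn : n ≠ 0) {f : Ω → κ} (hf : FibMeas f) :
    ∑ i ∈ Finset.range n, shEnt ν (f ∘ R^[i]) ≤ n * shEnt (orbitAverage R ν n) f := by
  have hn' : (0 : ℝ) < n := by exact_mod_cast Nat.pos_of_ne_zero hn
  simp only [shEnt]
  rw [Finset.sum_comm, Finset.mul_sum]
  refine Finset.sum_le_sum fun k _ => ?_
  have := Real.concaveOn_negMulLog.le_map_sum (t := Finset.range n) (w := fun _ => (n : ℝ)⁻¹)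
    (p := fun i => ν.real (R^[i] ⁻¹' (f ⁻¹' {k}))) (fun _ _ => by positivity)
    (by simp [hn'.ne']) (fun _ _ => measureReal_nonneg)
  simp only [smul_eq_mul, ← Finset.mul_sum] at this
  rw [orbitAverage_real hR ν n (hf k)]
  calc _ = (n : ℝ) * ((n : ℝ)⁻¹ * ∑ i ∈ Finset.range n,
        Real.negMulLog (ν.real (R^[i] ⁻¹' (f ⁻¹' {k})))) := by
        rw [mul_inv_cancel_left₀ hn'.ne']; rfl
    _ ≤ _ := mul_le_mul_of_nonneg_left this hn'.le

lemma sum_range_shift_sub (a : ℕ → ℝ) (m n : ℕ) :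
    ∑ k ∈ Finset.range n, (a (k + m) - a k) = ∑ j ∈ Finset.range m, (a (n + j) - a j) := by
  induction n with
  | zero => simp
  | succ n ih =>
    have : ∑ j ∈ Finset.range m, (a (n + 1 + j) - a j) =
        ∑ j ∈ Finset.range m, (a (n + j) - a j) +
          ∑ j ∈ Finset.range m, (a (n + (j + 1)) - a (n + j)) := by
      rw [← Finset.sum_add_distrib]
      refine Finset.sum_congr rfl fun j _ => ?_
      rw [show n + 1 + j = n + (j + 1) by ring]; ring
    rw [Finset.sum_range_succ, ih, this, Finset.sum_range_sub (fun j => a (n + j)), add_zero]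

/-- Block entropies of an orbit average dominate the entropy of one long itinerary. -/
lemma mul_shEnt_word_le_orbitAverage {R : Ω → Ω} (hR : Measurable R) (ν : Measure Ω)
    [IsProbabilityMeasure ν] {n : ℕ} (hn : n ≠ 0) {f : Ω → κ} (hf : FibMeas f) (m : ℕ) :
    m * shEnt ν (word R f n) ≤
      n * shEnt (orbitAverage R ν n) (word R f m) + m * (m * Real.log (Fintype.card κ)) := by
  have h1 := sum_shEnt_comp_iterate_le hR ν hn (hf.word hR m)
  have h2 : ∑ k ∈ Finset.range n, (shEnt ν (word R f (k + m)) - shEnt ν (word R f k)) ≤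
      ∑ k ∈ Finset.range n, shEnt ν (word R f m ∘ R^[k]) :=
    Finset.sum_le_sum fun k _ => by linarith [shEnt_word_add_le ν hR hf k m]
  rw [sum_range_shift_sub fun k => shEnt ν (word R f k)] at h2
  have h3 : ∑ _j ∈ Finset.range m, (shEnt ν (word R f n) - m * Real.log (Fintype.card κ)) ≤
      ∑ j ∈ Finset.range m, (shEnt ν (word R f (n + j)) - shEnt ν (word R f j)) := by
    refine Finset.sum_le_sum fun j hj => ?_
    have := shEnt_word_mono ν hR hf (Nat.le_add_right n j)
    have h4 := shEnt_word_mono ν hR hf (Finset.mem_range.1 hj).le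
    linarith [shEnt_word_le_log ν hR hf m]
  rw [Finset.sum_const, Finset.card_range, nsmul_eq_mul] at h3
  linarith

/-- A finite set on which all given functions are injective, maximal in the sense that any point
agrees with one of its points under one of the functions. -/
lemma exists_maximal_injOn {Ω κ σ : Type*} [Fintype κ] [Nonempty Ω] {F : Finset σ}
    (hF : F.Nonempty) (Φ : σ → Ω → κ) :
    ∃ B : Finset Ω, B.Nonempty ∧ (∀ a ∈ F, Set.InjOn (Φ a) B) ∧
      ∀ x, ∃ a ∈ F, ∃ b ∈ B, Φ a x = Φ a b := by
  obtain ⟨a₀, ha₀⟩ := hF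
  let P : ℕ → Prop := fun k => ∃ B : Finset Ω, B.card = k ∧ ∀ a ∈ F, Set.InjOn (Φ a) B
  have hbd : ∀ k, P k → k ≤ Fintype.card κ := by
    rintro k ⟨B, rfl, hB⟩
    rw [← Finset.card_image_of_injOn (hB a₀ ha₀)]
    exact Finset.card_le_univ _
  obtain ⟨x₀⟩ := ‹Nonempty Ω›
  have h1 : P 1 := ⟨{x₀}, by simp, by simp⟩
  have hmax : P (Nat.findGreatest P (Fintype.card κ)) := Nat.findGreatest_spec (hbd 1 h1) h1
  obtain ⟨B, hBc, hB⟩ := id hmax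
  refine ⟨B, ?_, hB, fun x => ?_⟩
  · rw [← Finset.card_pos, hBc]
    exact lt_of_lt_of_le one_pos (Nat.le_findGreatest (hbd 1 h1) h1)
  · by_cases hx : x ∈ B
    · exact ⟨a₀, ha₀, x, hx, rfl⟩
    by_contra! hne
    have hP : P (B.card + 1) := by
      refine ⟨insert x B, Finset.card_insert_of_notMem hx, fun a ha => ?_⟩
      rw [Finset.coe_insert, Set.injOn_insert (by exact_mod_cast hx)]
      refine ⟨hB a ha, ?_⟩
      rintro ⟨b, hb, hxb⟩
      exact hne a ha b hb hxb.symm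
    have := Nat.le_findGreatest (hbd _ hP) hP
    omega

/-- The uniform measure on a finite set on which `f` is injective has maximal entropy. -/
lemma exists_measure_shEnt_eq_log_card {B : Finset Ω} (hB : B.Nonempty) :
    ∃ ν : Measure Ω, IsProbabilityMeasure ν ∧ ∀ (κ : Type _) [Fintype κ] (f : Ω → κ), FibMeas f →
      Set.InjOn f B → Real.log B.card ≤ shEnt ν f := by
  refine ⟨(PMF.uniformOfFinset B hB).toMeasure, inferInstance, fun κ _ f hf hinj => ?_⟩
  set ν := (PMF.uniformOfFinset B hB).toMeasure with hν
  rw [← mul_one (Real.log _), ← sum_measureReal_fiber ν hf, Finset.mul_sum]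
  refine Finset.sum_le_sum fun k _ => ?_
  have hval : ν.real (f ⁻¹' {k}) = ((B.filter fun x => x ∈ f ⁻¹' {k}).card : ℝ) / B.card := by
    rw [measureReal_def, hν, PMF.toMeasure_uniformOfFinset_apply _ _ (hf k)]
    simp
  have hle : (B.filter fun x => x ∈ f ⁻¹' {k}).card ≤ 1 := by
    refine Finset.card_le_one.2 fun x hx y hy => ?_
    rw [Finset.mem_filter] at hx hy
    exact hinj hx.1 hy.1 (hx.2.trans hy.2.symm)
  rcases Nat.le_one_iff_eq_zero_or_eq_one.1 hle with h | h
  · rw [hval, h]; simp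
  · rw [hval, h, Real.negMulLog, Nat.cast_one, one_div, Real.log_inv]
    exact le_of_eq (by ring)

end Averages

section Limits

variable {Z : Type*} [TopologicalSpace Z] [CompactSpace Z] [TopologicalSpace.MetrizableSpace Z]
  [TotallyDisconnectedSpace Z] [MeasurableSpace Z] [BorelSpace Z]

omit [CompactSpace Z] [TotallyDisconnectedSpace Z] in
lemma tendsto_real_of_isClopen {J : Type*} {l : Filter J} {νs : J → ProbabilityMeasure Z}
    {ν : ProbabilityMeasure Z} (h : Tendsto νs l (𝓝 ν)) {C : Set Z} (hC : IsClopen C) :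
    Tendsto (fun i => (νs i : Measure Z).real C) l (𝓝 ((ν : Measure Z).real C)) :=
  (NNReal.continuous_coe.tendsto _).comp
    (ProbabilityMeasure.tendsto_measure_of_isClopen_of_tendsto h hC)

omit [CompactSpace Z] [TotallyDisconnectedSpace Z] in
lemma tendsto_shEnt_of_clopenFib {J κ : Type*} [Fintype κ] {l : Filter J}
    {νs : J → ProbabilityMeasure Z} {ν : ProbabilityMeasure Z} (h : Tendsto νs l (𝓝 ν))
    {f : Z → κ} (hf : ClopenFib f) :
    Tendsto (fun i => shEnt (νs i : Measure Z) f) l (𝓝 (shEnt (ν : Measure Z) f)) :=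
  tendsto_finsetSum _ fun k _ => (Real.continuous_negMulLog.tendsto _).comp
    (tendsto_real_of_isClopen h (hf k))

/-- In a zero-dimensional compact space, clopen sets determine finite measures. -/
lemma ext_of_isClopen {μ ν : Measure Z} [IsProbabilityMeasure μ] [IsProbabilityMeasure ν]
    (h : ∀ C, IsClopen C → μ.real C = ν.real C) : μ = ν := by
  have hgen := BorelSpace.measurable_eq (α := Z)
  have : SecondCountableTopology Z := by
    let := TopologicalSpace.metrizableSpaceMetric Z
    infer_instance
  rw [(isTopologicalBasis_isClopen (X := Z)).borel_eq_generateFrom] at hgen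
  refine ext_of_generate_finite _ hgen ?_ (fun C hC => ?_) (by simp)
  · intro A hA B hB _
    exact IsClopen.inter hA hB
  · rw [← measureReal_eq_measureReal_iff]
    exact h C hC

lemma measurePreserving_of_tendsto {J : Type*} {l : Filter J} [l.NeBot] {R : Z → Z}
    (hR : Continuous R) {νs : J → ProbabilityMeasure Z} {ν : ProbabilityMeasure Z}
    (h : Tendsto νs l (𝓝 ν))
    (hinv : ∀ C, IsClopen C → Tendsto (fun i => (νs i : Measure Z).real (R ⁻¹' C) -
      (νs i : Measure Z).real C) l (𝓝 0)) :
    MeasurePreserving R (ν : Measure Z) (ν : Measure Z) := by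
  refine ⟨hR.measurable, ?_⟩
  have := Measure.isProbabilityMeasure_map (μ := (ν : Measure Z)) hR.measurable.aemeasurable
  refine ext_of_isClopen fun C hC => ?_
  rw [map_measureReal_apply hR.measurable hC.isClosed.measurableSet]
  have h1 := (tendsto_real_of_isClopen h (hC.preimage hR)).sub (tendsto_real_of_isClopen h hC)
  exact sub_eq_zero.1 (tendsto_nhds_unique h1 (hinv C hC))

variable {ι : Type*} [Fintype ι]

/-- The measure is invariant, and all clopen labellings subordinate to `V` have block entropies
growing at least at rate `c`. -/
def EntropyAtLeast {Z ι : Type*} [TopologicalSpace Z] [MeasurableSpace Z] [Fintype ι] (R : Z → Z)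
    (V : ι → Set Z) (c : ℝ) (ν : Measure Z) : Prop :=
  MeasurePreserving R ν ν ∧ ∀ f : Z → ι, ClopenFib f → (∀ z, z ∈ V (f z)) →
    ∀ m : ℕ, m * c ≤ shEnt ν (word R f m)

lemma EntropyAtLeast.of_tendsto {J : Type*} {l : Filter J} [l.NeBot] {R : Z → Z}
    (hR : Continuous R) {V : ι → Set Z} {νs : J → ProbabilityMeasure Z}
    {ν : ProbabilityMeasure Z} (h : Tendsto νs l (𝓝 ν)) {cs : J → ℝ} {c : ℝ}
    (hc : Tendsto cs l (𝓝 c)) (hν : ∀ i, EntropyAtLeast R V (cs i) (νs i : Measure Z)) :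
    EntropyAtLeast R V c (ν : Measure Z) := by
  refine ⟨measurePreserving_of_tendsto hR h fun C hC => ?_, fun f hf hfV m => ?_⟩
  · refine tendsto_const_nhds.congr fun i => ?_
    rw [measureReal_def, (hν i).1.measure_preimage hC.isClosed.measurableSet.nullMeasurableSet,
      ← measureReal_def, sub_self]
  · exact le_of_tendsto_of_tendsto' (hc.const_mul (m : ℝ))
      (tendsto_shEnt_of_clopenFib h (hf.word hR m)) fun i => (hν i).2 f hf hfV m

omit [TotallyDisconnectedSpace Z] in
lemma exists_tendsto_ultrafilter {J : Type*} (l : Filter J) [l.NeBot]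
    (νs : J → ProbabilityMeasure Z) :
    ∃ (u : Filter J) (_ : u.NeBot) (ν : ProbabilityMeasure Z), u ≤ l ∧ Tendsto νs u (𝓝 ν) := by
  obtain ⟨ν, -, hν⟩ := isCompact_univ.ultrafilter_le_nhds
    ((Ultrafilter.of l).map νs) (by simp)
  exact ⟨Ultrafilter.of l, inferInstance, ν, Ultrafilter.of_le l, hν⟩

/-- If every finite family of subordinate itineraries sees at least `exp (n * h)` words, some
invariant measure has block entropies growing at rate `h` along all of the family. -/
lemma exists_measure_of_finset [Nonempty Z] [Nonempty ι] {R : Z → Z} (hR : Continuous R)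
    {V : ι → Set Z} {h : ℝ}
    (hN : ∀ (n : ℕ) (W : Finset (Fin n → ι)), (∀ z, ∃ w ∈ W, ∀ j : Fin n, R^[j] z ∈ V (w j)) →
      n * h ≤ Real.log W.card)
    (F : Finset (Z → ι)) (hF : ∀ f ∈ F, ClopenFib f ∧ ∀ z, z ∈ V (f z)) (hne : F.Nonempty) :
    ∃ ν : ProbabilityMeasure Z, MeasurePreserving R (ν : Measure Z) (ν : Measure Z) ∧
      ∀ f ∈ F, ∀ m : ℕ, m * h ≤ shEnt (ν : Measure Z) (word R f m) := by
  have hRm := hR.measurable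
  have hFc : (0 : ℝ) < F.card := by exact_mod_cast hne.card_pos
  have step : ∀ n : ℕ, ∃ ν : Measure Z, IsProbabilityMeasure ν ∧ ∀ f ∈ F,
      n * h - Real.log F.card ≤ shEnt ν (word R f n) := by
    intro n
    obtain ⟨B, hB, hinj, hmax⟩ := exists_maximal_injOn hne fun f => word R f n
    have hBc : (0 : ℝ) < B.card := by exact_mod_cast hB.card_pos
    obtain ⟨ν, hν, hent⟩ := exists_measure_shEnt_eq_log_card hB
    refine ⟨ν, hν, fun f hf => le_trans ?_
      (hent _ _ ((hF f hf).1.fibMeas.word hRm n) (hinj f hf))⟩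
    have h1 := hN n ((F ×ˢ B).image fun p => word R p.1 n p.2) fun z => by
      obtain ⟨f, hf, b, hb, hfb⟩ := hmax z
      refine ⟨word R f n b, Finset.mem_image.2 ⟨(f, b), Finset.mk_mem_product hf hb, rfl⟩,
        fun j => ?_⟩
      rw [← hfb]
      exact (hF f hf).2 _
    have h2 : (((F ×ˢ B).image fun p => word R p.1 n p.2).card : ℝ) ≤ F.card * B.card := by
      have := (Finset.card_image_le (s := F ×ˢ B) (f := fun p => word R p.1 n p.2)).trans_eq
        (Finset.card_product F B)
      exact_mod_cast this
    have h3 : (0 : ℝ) < ((F ×ˢ B).image fun p => word R p.1 n p.2).card := by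
      exact_mod_cast ((hne.product hB).image _).card_pos
    have h4 := Real.log_le_log h3 h2
    rw [Real.log_mul hFc.ne' hBc.ne'] at h4
    linarith
  choose ν hνp hν using step
  let νs : ℕ → ProbabilityMeasure Z := fun n =>
    ⟨orbitAverage R (ν (n + 1)) (n + 1), isProbabilityMeasure_orbitAverage hRm _ n.succ_ne_zero⟩
  obtain ⟨u, hu, ν', hul, hlim⟩ := exists_tendsto_ultrafilter atTop νs
  have hinv : Tendsto (fun n : ℕ => ((n + 1 : ℕ) : ℝ)⁻¹) u (𝓝 0) :=
    ((tendsto_inv_atTop_nhds_zero_nat (𝕜 := ℝ)).comp (tendsto_add_atTop_nat 1)).mono_left hul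
  refine ⟨ν', measurePreserving_of_tendsto hR hlim fun C hC => ?_, fun f hf m => ?_⟩
  · exact squeeze_zero_norm (fun n => abs_orbitAverage_preimage_sub_le hRm (ν (n + 1)) (n + 1)
      hC.isClosed.measurableSet) hinv
  · have hlow : ∀ n : ℕ, m * h - (m * Real.log F.card + m * (m * Real.log (Fintype.card ι))) *
        ((n + 1 : ℕ) : ℝ)⁻¹ ≤ shEnt (νs n : Measure Z) (word R f m) := fun n => by
      have h1 := mul_shEnt_word_le_orbitAverage hRm (ν (n + 1)) n.succ_ne_zero
        (hF f hf).1.fibMeas m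
      have h2 := mul_le_mul_of_nonneg_left (hν (n + 1) f hf) (Nat.cast_nonneg (α := ℝ) m)
      have hn : (0 : ℝ) < (n + 1 : ℕ) := by positivity
      rw [sub_le_iff_le_add, ← mul_le_mul_iff_right₀ hn]
      have h3 : ((n + 1 : ℕ) : ℝ) * ((m * Real.log F.card +
          m * (m * Real.log (Fintype.card ι))) * ((n + 1 : ℕ) : ℝ)⁻¹) =
          m * Real.log F.card + m * (m * Real.log (Fintype.card ι)) := by
        field_simp
      rw [mul_add, h3]
      show ((n + 1 : ℕ) : ℝ) * (m * h) ≤ ((n + 1 : ℕ) : ℝ) *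
        shEnt (orbitAverage R (ν (n + 1)) (n + 1)) (word R f m) + _
      have h4 : ((n + 1 : ℕ) : ℝ) * (m * h) = m * ((n + 1 : ℕ) * h - Real.log F.card) +
        m * Real.log F.card := by ring
      rw [h4]
      linarith
    refine le_of_tendsto_of_tendsto' ?_
      (tendsto_shEnt_of_clopenFib hlim ((hF f hf).1.word hR m)) hlow
    simpa using tendsto_const_nhds.sub (hinv.const_mul _)

lemma exists_entropyAtLeast [Nonempty Z] [Nonempty ι] {R : Z → Z} (hR : Continuous R)
    {V : ι → Set Z} (hV : ∀ i, IsOpen (V i)) (hcov : ∀ z, ∃ i, z ∈ V i) {h : ℝ}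
    (hN : ∀ (n : ℕ) (W : Finset (Fin n → ι)), (∀ z, ∃ w ∈ W, ∀ j : Fin n, R^[j] z ∈ V (w j)) →
      n * h ≤ Real.log W.card) :
    ∃ ν : ProbabilityMeasure Z, EntropyAtLeast R V h (ν : Measure Z) := by
  let A := {f : Z → ι // ClopenFib f ∧ ∀ z, z ∈ V (f z)}
  obtain ⟨f₀, hf₀⟩ := exists_clopenFib_label hV hcov
  have key : ∀ F : Finset A, ∃ ν : ProbabilityMeasure Z,
      MeasurePreserving R (ν : Measure Z) (ν : Measure Z) ∧
      ∀ f ∈ F, ∀ m : ℕ, m * h ≤ shEnt (ν : Measure Z) (word R f.1 m) := by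
    intro F
    obtain ⟨ν, hν, hν'⟩ := exists_measure_of_finset hR hN
      ((insert (⟨f₀, hf₀⟩ : A) F).image Subtype.val) (by
        intro f hf
        obtain ⟨a, -, rfl⟩ := Finset.mem_image.1 hf
        exact a.2) ((Finset.insert_nonempty _ _).image _)
    exact ⟨ν, hν, fun f hf => hν' _
      (Finset.mem_image_of_mem _ (Finset.mem_insert_of_mem hf))⟩
  choose νs hinv hent using key
  obtain ⟨u, hu, ν, hul, hlim⟩ := exists_tendsto_ultrafilter atTop νs
  refine ⟨ν, measurePreserving_of_tendsto hR hlim fun C hC => ?_, fun f hf hfV m => ?_⟩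
  · refine tendsto_const_nhds.congr fun F => ?_
    rw [measureReal_def, (hinv F).measure_preimage hC.isClosed.measurableSet.nullMeasurableSet,
      ← measureReal_def, sub_self]
  · refine ge_of_tendsto (tendsto_shEnt_of_clopenFib hlim (hf.word hR m)) ?_
    filter_upwards [hul (eventually_ge_atTop ({⟨f, hf, hfV⟩} : Finset A))] with F hF
    exact hent F _ (Finset.singleton_subset_iff.1 hF) m

end Limits

section Ergodic

open ProbabilityTheory

variable {Ω κ : Type*} [MeasurableSpace Ω] [Fintype κ]

lemma negMulLog_add_le {a b : ℝ} (ha : 0 ≤ a) (hb : 0 ≤ b) :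
    Real.negMulLog (a + b) ≤ Real.negMulLog a + Real.negMulLog b := by
  rcases ha.eq_or_lt with rfl | ha
  · simp
  rcases hb.eq_or_lt with rfl | hb
  · simp
  simp only [Real.negMulLog]
  nlinarith [Real.log_le_log ha (by linarith : a ≤ a + b),
    Real.log_le_log hb (by linarith : b ≤ a + b)]

lemma measureReal_eq_cond_add_cond (ν : Measure Ω) [IsProbabilityMeasure ν] {A : Set Ω}
    (hA : MeasurableSet A) (S : Set Ω) :
    ν.real S = ν.real A * ν[|A].real S + ν.real Aᶜ * ν[|Aᶜ].real S := by
  have h : ∀ B, MeasurableSet B → ν.real B * ν[|B].real S = ν.real (B ∩ S) := fun B hB => by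
    rw [measureReal_def, measureReal_def, measureReal_def, ← ENNReal.toReal_mul,
      mul_comm (ν B), cond_mul_eq_inter hB]
  rw [h A hA, h Aᶜ hA.compl, Set.inter_comm, Set.inter_comm Aᶜ, ← Set.sdiff_eq,
    measureReal_inter_add_sdiff hA]

lemma cond_real_eq_inter (ν : Measure Ω) {A : Set Ω} (hA : MeasurableSet A) (S : Set Ω) :
    ν[|A].real S = ν[|A].real (A ∩ S) := by
  rw [measureReal_def, measureReal_def, cond_apply hA, cond_apply hA, ← Set.inter_assoc,
    Set.inter_self]

/-- Entropy of a labelling glued from two labellings along a set. -/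
lemma shEnt_piecewise_le (ν : Measure Ω) [IsProbabilityMeasure ν] {A : Set Ω}
    (hA : MeasurableSet A) (hA0 : ν A ≠ 0) (hA1 : ν Aᶜ ≠ 0) {f g : Ω → κ} (hf : FibMeas f)
    (hg : FibMeas g) :
    shEnt ν (A.piecewise f g) ≤ ν.real A * shEnt ν[|A] f + ν.real Aᶜ * shEnt ν[|Aᶜ] g +
      (Real.negMulLog (ν.real A) + Real.negMulLog (ν.real Aᶜ)) := by
  have := cond_isProbabilityMeasure hA0
  have := cond_isProbabilityMeasure hA1
  have hval : ∀ k, ν.real (A.piecewise f g ⁻¹' {k}) =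
      ν.real A * ν[|A].real (f ⁻¹' {k}) + ν.real Aᶜ * ν[|Aᶜ].real (g ⁻¹' {k}) := fun k => by
    have e1 : A ∩ A.piecewise f g ⁻¹' {k} = A ∩ f ⁻¹' {k} := by
      ext x
      refine and_congr_right fun hx => ?_
      rw [Set.mem_preimage, Set.piecewise_eq_of_mem _ _ _ hx, Set.mem_preimage]
    have e2 : Aᶜ ∩ A.piecewise f g ⁻¹' {k} = Aᶜ ∩ g ⁻¹' {k} := by
      ext x
      refine and_congr_right fun hx => ?_
      rw [Set.mem_preimage, Set.piecewise_eq_of_notMem _ _ _ hx, Set.mem_preimage]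
    rw [measureReal_eq_cond_add_cond ν hA, cond_real_eq_inter ν hA, e1,
      cond_real_eq_inter ν hA.compl, e2, ← cond_real_eq_inter ν hA,
      ← cond_real_eq_inter ν hA.compl]
  have hterm : ∀ k, Real.negMulLog (ν.real (A.piecewise f g ⁻¹' {k})) ≤
      (ν.real A * Real.negMulLog (ν[|A].real (f ⁻¹' {k})) +
        ν.real Aᶜ * Real.negMulLog (ν[|Aᶜ].real (g ⁻¹' {k}))) +
      (ν[|A].real (f ⁻¹' {k}) * Real.negMulLog (ν.real A) +
        ν[|Aᶜ].real (g ⁻¹' {k}) * Real.negMulLog (ν.real Aᶜ)) := fun k => by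
    rw [hval]
    refine (negMulLog_add_le (by positivity) (by positivity)).trans (le_of_eq ?_)
    rw [Real.negMulLog_mul, Real.negMulLog_mul]; ring
  refine (Finset.sum_le_sum fun k _ => hterm k).trans (le_of_eq ?_)
  simp only [Finset.sum_add_distrib, ← Finset.mul_sum, ← Finset.sum_mul,
    sum_measureReal_fiber _ hf, sum_measureReal_fiber _ hg, one_mul, shEnt]

lemma measurePreserving_cond {ν : Measure Ω} {R : Ω → Ω} (hR : MeasurePreserving R ν ν)
    {A : Set Ω} (hA : MeasurableSet A) (hinv : R ⁻¹' A = A) :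
    MeasurePreserving R ν[|A] ν[|A] := by
  refine ⟨hR.measurable, Measure.ext fun S hS => ?_⟩
  rw [Measure.map_apply hR.measurable hS, cond_apply hA, cond_apply hA]
  congr 1
  rw [← hR.measure_preimage (hA.inter hS).nullMeasurableSet, Set.preimage_inter, hinv]

lemma iterate_mem_iff_of_preimage_eq {Ω : Type*} {R : Ω → Ω} {A : Set Ω}
    (hinv : R ⁻¹' A = A) (n : ℕ) (x : Ω) : R^[n] x ∈ A ↔ x ∈ A := by
  induction n with
  | zero => rfl
  | succ n ih =>
    rw [Function.iterate_succ_apply', ← ih, ← Set.mem_preimage, hinv]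

lemma word_piecewise {Ω κ : Type*} {R : Ω → Ω} {A : Set Ω} (hinv : R ⁻¹' A = A) (f g : Ω → κ)
    (n : ℕ) : word R (A.piecewise f g) n = A.piecewise (word R f n) (word R g n) := by
  ext x j
  by_cases hx : x ∈ A
  · rw [Set.piecewise_eq_of_mem _ _ _ hx]
    exact Set.piecewise_eq_of_mem _ _ _ ((iterate_mem_iff_of_preimage_eq hinv j x).2 hx)
  · rw [Set.piecewise_eq_of_notMem _ _ _ hx]
    exact Set.piecewise_eq_of_notMem _ _ _
      (mt (iterate_mem_iff_of_preimage_eq hinv j x).1 hx)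

lemma FibMeas.piecewise {κ : Type*} {A : Set Ω} (hA : MeasurableSet A) {f g : Ω → κ}
    (hf : FibMeas f) (hg : FibMeas g) : FibMeas (A.piecewise f g) := fun i => by
  rw [Set.piecewise_preimage, Set.ite]
  exact ((hf i).inter hA).union ((hg i).diff hA)

variable {Z ι : Type*} [TopologicalSpace Z] [CompactSpace Z] [TopologicalSpace.MetrizableSpace Z]
  [TotallyDisconnectedSpace Z] [MeasurableSpace Z] [BorelSpace Z] [Fintype ι] [Nonempty ι]

/-- If the rate is maximal, it is attained by all conditional measures on invariant sets. -/
lemma EntropyAtLeast.cond {R : Z → Z} {V : ι → Set Z} (hV : ∀ i, IsOpen (V i)) {c : ℝ}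
    {ν : Measure Z} [IsProbabilityMeasure ν] (hν : EntropyAtLeast R V c ν)
    (hmax : ∀ (c' : ℝ) (ν' : ProbabilityMeasure Z), EntropyAtLeast R V c' (ν' : Measure Z) →
      c' ≤ c)
    {A : Set Z} (hA : MeasurableSet A) (hinv : R ⁻¹' A = A) (hA0 : ν A ≠ 0) (hA1 : ν Aᶜ ≠ 0) :
    EntropyAtLeast R V c ν[|A] := by
  have hP1 := cond_isProbabilityMeasure hA0
  have hP2 := cond_isProbabilityMeasure hA1
  have h1 := measurePreserving_cond hν.1 hA hinv
  have h2 := measurePreserving_cond hν.1 hA.compl (by rw [Set.preimage_compl, hinv])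
  refine ⟨h1, fun f hf hfV m => ?_⟩
  by_contra! hlt
  have hm : m ≠ 0 := by
    rintro rfl
    have := shEnt_nonneg ν[|A] (word R f 0)
    simp only [Nat.cast_zero, zero_mul] at hlt
    linarith
  have hm' : (0 : ℝ) < m := by exact_mod_cast Nat.pos_of_ne_zero hm
  have hp : 0 < ν.real A := ENNReal.toReal_pos hA0 (measure_ne_top _ _)
  have hq1 : ν.real Aᶜ ≤ 1 := measureReal_le_one
  have hq0 : 0 ≤ ν.real Aᶜ := measureReal_nonneg
  have hpq : ν.real A + ν.real Aᶜ = 1 := by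
    rw [measureReal_add_measureReal_compl hA]; simp
  obtain ⟨d, hd, hdm⟩ : ∃ d > 0, shEnt ν[|A] (word R f m) ≤ m * (c - d) := by
    refine ⟨c - shEnt ν[|A] (word R f m) / m, ?_, ?_⟩
    · rw [gt_iff_lt, sub_pos, div_lt_iff₀ hm']; linarith
    · rw [sub_sub_cancel, mul_div_cancel₀ _ hm'.ne']
  set ε := ν.real A * d / 2 with hε
  have hε0 : 0 < ε := by positivity
  have hnot : ¬ EntropyAtLeast R V (c + ε) ν[|Aᶜ] := fun h => by
    have := hmax _ ⟨_, hP2⟩ h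
    linarith
  have : ∃ g : Z → ι, ClopenFib g ∧ (∀ z, z ∈ V (g z)) ∧
      ∃ m' : ℕ, shEnt ν[|Aᶜ] (word R g m') < m' * (c + ε) := by
    by_contra! hcon
    exact hnot ⟨h2, hcon⟩
  obtain ⟨g, hg, hgV, m', hm2⟩ := this
  have hm'0 : m' ≠ 0 := by
    rintro rfl
    have := shEnt_nonneg ν[|Aᶜ] (word R g 0)
    simp only [Nat.cast_zero, zero_mul] at hm2
    linarith
  set C := Real.negMulLog (ν.real A) + Real.negMulLog (ν.real Aᶜ) with hC
  obtain ⟨k, hk⟩ := exists_nat_gt (C / ε)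
  rw [div_lt_iff₀ hε0] at hk
  have hβ : ∀ N : ℕ, N * c ≤ ν.real A * shEnt ν[|A] (word R f N) +
      ν.real Aᶜ * shEnt ν[|Aᶜ] (word R g N) + C := fun N => by
    refine (le_shEnt_word_of_clopenFib hν.1 hV (fun f' hf' hfV' => hν.2 f' hf' hfV' N)
      (FibMeas.piecewise hA hf.fibMeas hg.fibMeas) fun z => ?_).trans ?_
    · by_cases hz : z ∈ A
      · rw [Set.piecewise_eq_of_mem _ _ _ hz]; exact hfV z
      · rw [Set.piecewise_eq_of_notMem _ _ _ hz]; exact hgV z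
    · rw [word_piecewise hinv]
      exact shEnt_piecewise_le ν hA hA0 hA1 (hf.fibMeas.word h1.measurable N)
        (hg.fibMeas.word h1.measurable N)
  have hf1 := shEnt_word_mul_le h1 hf.fibMeas (k * m') m
  have hg1 := shEnt_word_mul_le h2 hg.fibMeas (k * m) m'
  rw [show k * m * m' = k * m' * m by ring] at hg1
  have hN := hβ (k * m' * m)
  have hf2 : shEnt ν[|A] (word R f (k * m' * m)) ≤ ((k * m' * m : ℕ) : ℝ) * (c - d) := by
    refine hf1.trans ((mul_le_mul_of_nonneg_left hdm (by positivity)).trans_eq ?_)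
    push_cast; ring
  have hg2 : shEnt ν[|Aᶜ] (word R g (k * m' * m)) ≤ ((k * m' * m : ℕ) : ℝ) * (c + ε) := by
    refine hg1.trans ((mul_le_mul_of_nonneg_left hm2.le (by positivity)).trans_eq ?_)
    push_cast; ring
  have hkN : (k : ℝ) ≤ ((k * m' * m : ℕ) : ℝ) := by
    rw [mul_assoc]
    exact_mod_cast Nat.le_mul_of_pos_right k
      (Nat.mul_pos (Nat.pos_of_ne_zero hm'0) (Nat.pos_of_ne_zero hm))
  set N : ℝ := ((k * m' * m : ℕ) : ℝ)
  have hN0 : 0 ≤ N := le_trans (Nat.cast_nonneg k) hkN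
  have e1 := mul_le_mul_of_nonneg_left hf2 hp.le
  have e2 := mul_le_mul_of_nonneg_left hg2 hq0
  have e3 : ν.real Aᶜ * (N * ε) ≤ 1 * (N * ε) :=
    mul_le_mul_of_nonneg_right hq1 (by positivity)
  have e4 : (k : ℝ) * ε ≤ N * ε := mul_le_mul_of_nonneg_right hkN hε0.le
  have e5 : ν.real A * (N * (c - d)) + ν.real Aᶜ * (N * (c + ε)) =
      N * c * (ν.real A + ν.real Aᶜ) - 2 * (N * ε) + ν.real Aᶜ * (N * ε) := by
    rw [hε]; ring
  rw [hpq] at e5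
  linarith

omit [Nonempty ι] in
lemma isClosed_entropyAtLeast {R : Z → Z} (hR : Continuous R) (V : ι → Set Z) (c : ℝ) :
    IsClosed {ν : ProbabilityMeasure Z | EntropyAtLeast R V c (ν : Measure Z)} := by
  refine isClosed_of_closure_subset fun ν hν => ?_
  have := mem_closure_iff_comap_neBot.1 hν
  exact EntropyAtLeast.of_tendsto hR (tendsto_comap (f := Subtype.val)) tendsto_const_nhds
    fun i : {ν : ProbabilityMeasure Z | EntropyAtLeast R V c (ν : Measure Z)} => i.2

/-- There is a maximal rate `c` for which some measure satisfies `EntropyAtLeast`. -/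
lemma exists_maximal_entropyAtLeast {R : Z → Z} (hR : Continuous R) {V : ι → Set Z}
    (hV : ∀ i, IsOpen (V i)) (hcov : ∀ z, ∃ i, z ∈ V i) {h : ℝ} {ν₀ : ProbabilityMeasure Z}
    (hν₀ : EntropyAtLeast R V h (ν₀ : Measure Z)) :
    ∃ c, h ≤ c ∧ (∃ ν : ProbabilityMeasure Z, EntropyAtLeast R V c (ν : Measure Z)) ∧
      ∀ (c' : ℝ) (ν' : ProbabilityMeasure Z), EntropyAtLeast R V c' (ν' : Measure Z) →
        c' ≤ c := by
  set E := {c : ℝ | ∃ ν : ProbabilityMeasure Z, EntropyAtLeast R V c (ν : Measure Z)} with hE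
  obtain ⟨f₀, hf₀, hf₀V⟩ := exists_clopenFib_label hV hcov
  have hbdd : BddAbove E := by
    refine ⟨Real.log (Fintype.card ι), ?_⟩
    rintro c ⟨ν, hν⟩
    have h1 := hν.2 f₀ hf₀ hf₀V 1
    have h2 := shEnt_word_le_log (ν : Measure Z) hR.measurable hf₀.fibMeas 1
    simp only [Nat.cast_one, one_mul] at h1 h2
    exact h1.trans h2
  have hne : E.Nonempty := ⟨h, ν₀, hν₀⟩
  obtain ⟨cs, -, hcs, hcE⟩ := exists_seq_tendsto_sSup hne hbdd
  choose νs hνs using hcE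
  obtain ⟨u, hu, ν, hul, hlim⟩ := exists_tendsto_ultrafilter atTop νs
  exact ⟨sSup E, le_csSup hbdd ⟨ν₀, hν₀⟩,
    ⟨ν, EntropyAtLeast.of_tendsto hR hlim (hcs.mono_left hul) hνs⟩,
    fun _ ν' hent => le_csSup hbdd ⟨ν', hent⟩⟩

/-- A strictly convex continuous functional on measures of a zero-dimensional space. -/
noncomputable def sqSum {Z : Type*} [MeasurableSpace Z] (C : ℕ → Set Z) (ν : Measure Z) : ℝ :=
  ∑' i, (1 / 2 : ℝ) ^ i * ν.real (C i) ^ 2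

lemma summable_sqSum (C : ℕ → Set Ω) (ν : Measure Ω) [IsProbabilityMeasure ν] :
    Summable fun i => (1 / 2 : ℝ) ^ i * ν.real (C i) ^ 2 :=
  Summable.of_nonneg_of_le (fun _ => by positivity)
    (fun _ => mul_le_of_le_one_right (by positivity)
      (pow_le_one₀ measureReal_nonneg measureReal_le_one)) summable_geometric_two

omit [CompactSpace Z] [TotallyDisconnectedSpace Z] in
lemma continuous_sqSum {C : ℕ → Set Z} (hC : ∀ i, IsClopen (C i)) :
    Continuous fun ν : ProbabilityMeasure Z => sqSum C (ν : Measure Z) := by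
  refine continuous_tsum (fun i => ?_) summable_geometric_two fun i ν => ?_
  · refine continuous_const.mul (Continuous.pow ?_ 2)
    exact continuous_iff_continuousAt.2 fun ν => tendsto_real_of_isClopen tendsto_id (hC i)
  · rw [Real.norm_of_nonneg (by positivity)]
    exact mul_le_of_le_one_right (by positivity)
      (pow_le_one₀ measureReal_nonneg measureReal_le_one)

/-- Mixing two measures strictly decreases `sqSum` unless they agree. -/
lemma measureReal_eq_of_sqSum_le {C : ℕ → Set Ω} {ν ν₁ ν₂ : Measure Ω} [IsProbabilityMeasure ν]
    [IsProbabilityMeasure ν₁] [IsProbabilityMeasure ν₂] {p q : ℝ} (hp : 0 < p) (hq : 0 < q)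
    (hpq : p + q = 1) (hν : ∀ i, ν.real (C i) = p * ν₁.real (C i) + q * ν₂.real (C i))
    (h₁ : sqSum C ν₁ ≤ sqSum C ν) (h₂ : sqSum C ν₂ ≤ sqSum C ν) (i : ℕ) :
    ν₁.real (C i) = ν₂.real (C i) := by
  have hs := summable_sqSum C ν
  have hs₁ := (summable_sqSum C ν₁).mul_left p
  have hs₂ := (summable_sqSum C ν₂).mul_left q
  set D : ℕ → ℝ := fun i => p * q * ((1 / 2 : ℝ) ^ i * (ν₁.real (C i) - ν₂.real (C i)) ^ 2)
    with hD
  have hDeq : D = fun i => p * ((1 / 2 : ℝ) ^ i * ν₁.real (C i) ^ 2) +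
      q * ((1 / 2 : ℝ) ^ i * ν₂.real (C i) ^ 2) - (1 / 2 : ℝ) ^ i * ν.real (C i) ^ 2 := by
    funext i
    rw [hν i, hD]
    have : q = 1 - p := by linarith
    subst this
    ring
  have hDs : Summable D := by rw [hDeq]; exact (hs₁.add hs₂).sub hs
  have hDt : ∑' i, D i = p * sqSum C ν₁ + q * sqSum C ν₂ - sqSum C ν := by
    rw [hDeq, (hs₁.add hs₂).tsum_sub hs, hs₁.tsum_add hs₂, tsum_mul_left, tsum_mul_left]
    rfl
  by_contra hne
  have hpos : 0 < ∑' i, D i := by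
    refine hDs.tsum_pos (fun j => by positivity) i ?_
    have := sub_ne_zero.2 hne
    positivity
  have : p * sqSum C ν₁ + q * sqSum C ν₂ ≤ (p + q) * sqSum C ν := by
    rw [add_mul]
    exact add_le_add (mul_le_mul_of_nonneg_left h₁ hp.le) (mul_le_mul_of_nonneg_left h₂ hq.le)
  rw [hpq, one_mul] at this
  linarith

/-- Some ergodic measure attains at least the rate `h`. -/
lemma exists_ergodic_entropyAtLeast {R : Z → Z} (hR : Continuous R) {V : ι → Set Z}
    (hV : ∀ i, IsOpen (V i)) (hcov : ∀ z, ∃ i, z ∈ V i) {h : ℝ} {ν₀ : ProbabilityMeasure Z}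
    (hν₀ : EntropyAtLeast R V h (ν₀ : Measure Z)) :
    ∃ ν : ProbabilityMeasure Z, Ergodic R (ν : Measure Z) ∧
      EntropyAtLeast R V h (ν : Measure Z) := by
  obtain ⟨c, hhc, ⟨ν₁, hν₁⟩, hmax⟩ := exists_maximal_entropyAtLeast hR hV hcov hν₀
  have : SecondCountableTopology Z := by
    let := TopologicalSpace.metrizableSpaceMetric Z
    infer_instance
  have : Countable (TopologicalSpace.Clopens Z) :=
    TopologicalSpace.Clopens.countable_iff_secondCountable.2 inferInstance
  obtain ⟨C, hC⟩ := exists_surjective_nat (TopologicalSpace.Clopens Z)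
  obtain ⟨ν, hν, hνmax⟩ := (isClosed_entropyAtLeast hR V c).isCompact.exists_isMaxOn ⟨ν₁, hν₁⟩
    (continuous_sqSum fun i => (C i).isClopen).continuousOn
  have hle : ∀ ν' : ProbabilityMeasure Z, EntropyAtLeast R V c (ν' : Measure Z) →
      sqSum (fun i => (C i : Set Z)) (ν' : Measure Z) ≤
        sqSum (fun i => (C i : Set Z)) (ν : Measure Z) := fun ν' h' =>
    isMaxOn_iff.1 hνmax ν' h'
  clear hνmax
  refine ⟨ν, ⟨hν.1, ⟨fun A hA hinv => ?_⟩⟩, hν.1, fun f hf hfV m => ?_⟩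
  · rw [eventuallyConst_set']
    by_contra hcon
    rw [not_or] at hcon
    have hA0 : (ν : Measure Z) A ≠ 0 := fun h0 => hcon.1 (ae_eq_empty.2 h0)
    have hA1 : (ν : Measure Z) Aᶜ ≠ 0 := fun h0 => hcon.2 (ae_eq_univ.2 h0)
    have hinv' : R ⁻¹' Aᶜ = Aᶜ := by rw [Set.preimage_compl, hinv]
    have hP1 := cond_isProbabilityMeasure hA0
    have hP2 := cond_isProbabilityMeasure hA1
    have k1 := EntropyAtLeast.cond hV hν hmax hA hinv hA0 hA1
    have k2 := EntropyAtLeast.cond hV hν hmax hA.compl hinv' hA1 (by rwa [compl_compl])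
    have hadd : (ν : Measure Z).real A + (ν : Measure Z).real Aᶜ = 1 := by
      rw [measureReal_add_measureReal_compl hA]; simp
    have heq := measureReal_eq_of_sqSum_le (C := fun i => (C i : Set Z))
      (ENNReal.toReal_pos hA0 (measure_ne_top _ _))
      (ENNReal.toReal_pos hA1 (measure_ne_top _ _)) hadd
      (fun i => measureReal_eq_cond_add_cond (ν : Measure Z) hA (C i))
      (hle ⟨_, hP1⟩ k1) (hle ⟨_, hP2⟩ k2)
    have hext : (ν : Measure Z)[|A] = (ν : Measure Z)[|Aᶜ] := ext_of_isClopen fun D hD => by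
      obtain ⟨i, hi⟩ := hC ⟨D, hD⟩
      have := heq i
      rwa [hi] at this
    have h1 : (ν : Measure Z)[|A] A = 1 := by
      rw [cond_apply hA, Set.inter_self, ENNReal.inv_mul_cancel hA0 (measure_ne_top _ _)]
    have h2 : (ν : Measure Z)[|Aᶜ] A = 0 := by
      rw [cond_apply hA.compl, Set.compl_inter_self, measure_empty, mul_zero]
    rw [hext, h2] at h1
    exact zero_ne_one h1
  · exact (mul_le_mul_of_nonneg_left hhc (Nat.cast_nonneg m)).trans (hν.2 f hf hfV m)

end Ergodic

/-- For a topological dynamical system `(X, T)` and a finite open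
cover `𝓤` of `X`, there is a `T`-invariant ergodic Borel probability measure `μ`
with `h_μ(𝓤, T) = h_top(𝓤, T)`. -/
theorem exists_ergodic_measure_cover_entropy_eq_top {X : Type*} [MetricSpace X]
    [CompactSpace X] [Nonempty X] [MeasurableSpace X] [BorelSpace X]
    (T : X ≃ₜ X) (U : Finset (Set X))
    (hUopen : ∀ A ∈ U, IsOpen A) (hUcov : ⋃₀ (U : Set (Set X)) = Set.univ) :
    ∃ μ : Measure X, IsProbabilityMeasure μ ∧ Ergodic ⇑T μ ∧
      hPlusC μ ⇑T U
        = limUnder atTop (fun n : ℕ => Real.log (covNfull (joinN ⇑T U n)) / n) := by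
  have hU : IsMCover U := ⟨fun A hA => (hUopen A hA).measurableSet, hUcov⟩
  obtain ⟨h, h0, hlim, htends, hle⟩ := exists_topEntropy (⇑T) hUcov
  obtain ⟨Z, _, _, _, _, R, π, hR, hπ, hπs, hsemi⟩ := exists_zeroDimensional_extension T.continuous
  have hZ : Nonempty Z := hπs.nonempty
  let _ : MeasurableSpace Z := borel Z
  have : BorelSpace Z := ⟨rfl⟩
  obtain ⟨a, ha⟩ := exists_label hUcov
  have : Nonempty ↥U := ⟨a (Classical.arbitrary X)⟩
  set V : ↥U → Set Z := fun i => π ⁻¹' i with hV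
  have hVo : ∀ i, IsOpen (V i) := fun i => (hUopen i i.2).preimage hπ
  have hVcov : ∀ z, ∃ i, z ∈ V i := fun z => ⟨a (π z), ha (π z)⟩
  have hiter : ∀ (n : ℕ) (z : Z), π (R^[n] z) = (⇑T)^[n] (π z) := fun n z =>
    (hsemi.iterate_right n).eq z
  obtain ⟨ν₀, hν₀⟩ := exists_entropyAtLeast hR hVo hVcov (h := h) fun n W hW => by
    refine (hle n).trans (Real.log_le_log (by exact_mod_cast covNfull_pos (⇑T) hUcov n) ?_)
    refine Nat.cast_le.2 (covNfull_le_card (⇑T) W fun x => ?_)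
    obtain ⟨z, rfl⟩ := hπs x
    obtain ⟨w, hw, hwz⟩ := hW z
    refine ⟨w, hw, fun j => ?_⟩
    rw [← hiter]
    exact hwz j
  obtain ⟨ν, hνe, hνh⟩ := exists_ergodic_entropyAtLeast hR hVo hVcov hν₀
  have hπm : MeasurePreserving π (ν : Measure Z) ((ν : Measure Z).map π) :=
    ⟨hπ.measurable, rfl⟩
  have hμ : IsProbabilityMeasure ((ν : Measure Z).map π) :=
    Measure.isProbabilityMeasure_map hπ.measurable.aemeasurable
  have herg : Ergodic ⇑T ((ν : Measure Z).map π) :=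
    hπm.ergodic_of_ergodic_semiconj hνe T.measurable hsemi
  refine ⟨_, hμ, herg, ?_⟩
  rw [hlim]
  refine le_antisymm ?_ ?_
  · exact hPlusC_le_topEntropy T.toMeasurableEquiv herg hU h0 htends
  · refine le_hPlusC herg.toMeasurePreserving hU fun g hg hgU n => ?_
    rw [shEnt_map _ (hg.word T.measurable n) hπ.measurable]
    have hword : word (⇑T) g n ∘ π = word R (g ∘ π) n := by
      ext z j
      simp only [word, Function.comp_apply, hiter]
    rw [hword]
    exact le_shEnt_word_of_clopenFib hνe.toMeasurePreserving hVo
      (fun f hf hfV => hνh.2 f hf hfV n) (hg.comp hπ.measurable) fun z => hgU (π z)
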